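/- arXiv:2109.11601 — 5 statements merged into one kernel-verified Lean document; each statement's English description precedes it below -/
import Mathlib

section
/- A non-exceptional semigroup S of polynomials is amenable if and only if the following two conditions are satisfied: S contains no free subsemigroup of rank 2, and S is cancellative. -/
/-- A real-valued function on `σ` is bounded. -/
def Bdd {σ : Type*} (f : σ → ℝ) : Prop := ∃ C : ℝ, ∀ s, |f s| ≤ C

/-- A mean on `σ`: a normalized positive real-linear functional on the space `ℓ∞(σ)`
of bounded real-valued functions on `σ`. -/
structure Mean (σ : Type*) where
  toFun : (σ → ℝ) → ℝ
  map_add' : ∀ f g : σ → ℝ, Bdd f → Bdd g → toFun (f + g) = toFun f + toFun g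
  map_smul' : ∀ (c : ℝ) (f : σ → ℝ), Bdd f → toFun (c • f) = c * toFun f
  nonneg' : ∀ f : σ → ℝ, Bdd f → (∀ s, 0 ≤ f s) → 0 ≤ toFun f
  one' : toFun (fun _ => (1 : ℝ)) = 1

/-- `M` is a left invariant mean on a set `S` of polynomials, regarded as a semigroup
with product `g·h := g ∘ h` (polynomial composition):  `M (g ↦ f (h ∘ g)) = M f`. -/
def PolyLeftInv (S : Set (Polynomial ℂ)) (M : Mean S) : Prop :=
  ∀ (h : S) (hc : ∀ g : S, (h : Polynomial ℂ).comp (g : Polynomial ℂ) ∈ S),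
    ∀ f : S → ℝ, Bdd f →
      M.toFun (fun g : S => f ⟨(h : Polynomial ℂ).comp (g : Polynomial ℂ), hc g⟩) = M.toFun f

/-- `M` is a right invariant mean on a set `S` of polynomials under composition:
`M (g ↦ f (g ∘ h)) = M f`. -/
def PolyRightInv (S : Set (Polynomial ℂ)) (M : Mean S) : Prop :=
  ∀ (h : S) (hc : ∀ g : S, (g : Polynomial ℂ).comp (h : Polynomial ℂ) ∈ S),
    ∀ f : S → ℝ, Bdd f →
      M.toFun (fun g : S => f ⟨(g : Polynomial ℂ).comp (h : Polynomial ℂ), hc g⟩) = M.toFun f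

/-- The affine conjugate `σ ∘ P ∘ σ⁻¹` of `P` by `σ(z) = a z + b` (with
`σ⁻¹(z) = a⁻¹ (z - b)`), as a polynomial. -/
noncomputable def affConj (a b : ℂ) (P : Polynomial ℂ) : Polynomial ℂ :=
  ((Polynomial.C a * Polynomial.X + Polynomial.C b).comp P).comp
    (Polynomial.C a⁻¹ * (Polynomial.X - Polynomial.C b))

/-- A polynomial is exceptional if it has degree at most one, or is affinely conjugate
to the power map `z ↦ z^{deg P}` or to `± T_{deg P}` where `T_n` is the degree-`n`
Chebyshev polynomial. -/
def IsExceptional (P : Polynomial ℂ) : Prop :=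
  P.natDegree ≤ 1 ∨
  ∃ a b : ℂ, a ≠ 0 ∧
    (affConj a b P = Polynomial.X ^ P.natDegree ∨
     affConj a b P = Polynomial.Chebyshev.T ℂ (P.natDegree : ℤ) ∨
     affConj a b P = -Polynomial.Chebyshev.T ℂ (P.natDegree : ℤ))

/-- `S` contains a free subsemigroup of rank `k` under composition: there are
`s 0, …, s (k-1) ∈ S` such that distinct nonempty words in the `s i` give distinct
polynomials (injectivity of the canonical homomorphism from the free semigroup on
`k` generators). -/
def PolyHasFreeSG (S : Set (Polynomial ℂ)) (k : ℕ) : Prop :=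
  ∃ s : Fin k → Polynomial ℂ, (∀ i, s i ∈ S) ∧
    ∀ l m : List (Fin k), l ≠ [] → m ≠ [] →
      (l.map s).foldr Polynomial.comp Polynomial.X =
        (m.map s).foldr Polynomial.comp Polynomial.X → l = m

/-- `S` is left cancellative for the product `g·h := g ∘ h`. -/
def PolyLeftCancellative (S : Set (Polynomial ℂ)) : Prop :=
  ∀ a ∈ S, ∀ b ∈ S, ∀ c ∈ S, a.comp b = a.comp c → b = c

/-- `S` is right cancellative for the product `g·h := g ∘ h`. -/
def PolyRightCancellative (S : Set (Polynomial ℂ)) : Prop :=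
  ∀ a ∈ S, ∀ b ∈ S, ∀ c ∈ S, b.comp a = c.comp a → b = c

/-- `S` is cancellative: both left and right cancellative. -/
def PolyCancellative (S : Set (Polynomial ℂ)) : Prop :=
  PolyLeftCancellative S ∧ PolyRightCancellative S

namespace PolySemigroup

open Polynomial

theorem comp_right_cancel {a b c : ℂ[X]} (ha : 0 < a.natDegree)
    (h : b.comp a = c.comp a) : b = c := by
  have h0 : (b - c).comp a = 0 := by rw [sub_comp, h, sub_self]
  rcases comp_eq_zero_iff.1 h0 with h1 | ⟨_, h1⟩
  · exact sub_eq_zero.1 h1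
  · rw [h1, natDegree_C] at ha
    exact absurd ha (lt_irrefl 0)

/-- The divided difference of `p` at `a`, `b` has degree `(deg p - 1) * d` when `a` and `b`
are polynomials of degree `d` with the same leading coefficient. -/
theorem exists_divided_difference {p a b : ℂ[X]} (hp : 0 < p.natDegree) (ha : 0 < a.natDegree)
    (hab : b.natDegree = a.natDegree) (hlc : b.leadingCoeff = a.leadingCoeff) :
    ∃ q : ℂ[X], p.comp a - p.comp b = q * (a - b) ∧ q ≠ 0 ∧
      q.natDegree = (p.natDegree - 1) * a.natDegree := by
  set n := p.natDegree
  set d := a.natDegree with hd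
  have ha0 : a.leadingCoeff ≠ 0 := by
    rw [Ne, leadingCoeff_eq_zero]; rintro rfl; simp [d] at ha
  let g : ℕ → ℂ[X] := fun k => ∑ i ∈ Finset.range k, a ^ i * b ^ (k - 1 - i)
  have hg_deg : ∀ k, (g k).natDegree ≤ (k - 1) * d := by
    intro k
    refine natDegree_sum_le_of_forall_le _ _ fun i hi => ?_
    rw [Finset.mem_range] at hi
    refine natDegree_mul_le.trans ?_
    rw [natDegree_pow, natDegree_pow, hab, ← add_mul]
    gcongr
    omega
  have hg_coeff : (g n).coeff ((n - 1) * d) = n * a.leadingCoeff ^ (n - 1) := by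
    simp only [g, finsetSum_coeff]
    rw [Finset.sum_congr rfl (g := fun _ => a.leadingCoeff ^ (n - 1))]
    · simp
    · intro i hi
      rw [Finset.mem_range] at hi
      have : (n - 1) * d = (a ^ i).natDegree + (b ^ (n - 1 - i)).natDegree := by
        rw [natDegree_pow, natDegree_pow, hab, ← add_mul]
        congr 1
        omega
      rw [this, coeff_mul_degree_add_degree, leadingCoeff_pow, leadingCoeff_pow, hlc, ← pow_add]
      congr 1
      omega
  let q : ℂ[X] := ∑ k ∈ Finset.range (n + 1), C (p.coeff k) * g k
  have hq_deg : q.natDegree ≤ (n - 1) * d := by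
    refine natDegree_sum_le_of_forall_le _ _ fun k hk => ?_
    rw [Finset.mem_range] at hk
    refine (natDegree_C_mul_le _ _).trans ((hg_deg k).trans ?_)
    gcongr ?_ * d
    omega
  have hq_coeff : q.coeff ((n - 1) * d) ≠ 0 := by
    have : q.coeff ((n - 1) * d) = p.coeff n * (n * a.leadingCoeff ^ (n - 1)) := by
      simp only [q, finsetSum_coeff, coeff_C_mul]
      rw [Finset.sum_range_succ, hg_coeff, Finset.sum_eq_zero, zero_add]
      intro k hk
      rw [Finset.mem_range] at hk
      rcases Nat.eq_zero_or_pos k with rfl | hk0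
      · simp [g]
      rw [coeff_eq_zero_of_natDegree_lt (p := g k), mul_zero]
      refine (hg_deg k).trans_lt ?_
      gcongr
    rw [this]
    have hn : (n : ℂ) ≠ 0 := by exact_mod_cast hp.ne'
    have hpn : p.coeff n ≠ 0 := by
      intro h
      have : p = 0 := leadingCoeff_eq_zero.1 h
      simp [n, this] at hp
    exact mul_ne_zero hpn (mul_ne_zero hn (pow_ne_zero _ ha0))
  refine ⟨q, ?_, fun h => hq_coeff (by simp [h]),
    natDegree_eq_of_le_of_coeff_ne_zero hq_deg hq_coeff⟩
  rw [comp, comp, eval₂_eq_sum_range, eval₂_eq_sum_range, ← Finset.sum_sub_distrib, Finset.sum_mul]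
  refine Finset.sum_congr rfl fun k _ => ?_
  rw [mul_assoc, (Commute.all a b).geom_sum₂_mul, mul_sub]

/-- Two right composition factors of equal degree of the same polynomial differ by an
affine left factor. -/
theorem exists_affine_of_comp_eq_comp {x y a b : ℂ[X]} (hx : 0 < x.natDegree)
    (ha : 0 < a.natDegree) (hab : a.natDegree = b.natDegree) (h : x.comp a = y.comp b) :
    ∃ l c : ℂ, a = C l * b + C c := by
  have ha0 : a.leadingCoeff ≠ 0 := by
    rw [Ne, leadingCoeff_eq_zero]; rintro rfl; simp at ha
  have hb0 : b.leadingCoeff ≠ 0 := by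
    rw [Ne, leadingCoeff_eq_zero]; rintro rfl; simp [hab] at ha
  set l := a.leadingCoeff / b.leadingCoeff with hl
  have hl0 : l ≠ 0 := div_ne_zero ha0 hb0
  set b' := C l * b with hb'
  have hlc : b'.leadingCoeff = a.leadingCoeff := by
    rw [hb', leadingCoeff_mul, leadingCoeff_C, hl, div_mul_cancel₀ _ hb0]
  have hdeg : b'.natDegree = a.natDegree := by rw [hb', natDegree_C_mul hl0, hab]
  obtain ⟨q, hq, hq0, hqd⟩ := exists_divided_difference hx ha hdeg hlc
  have hb : b = (C l⁻¹ * X).comp b' := by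
    rw [hb', mul_comp, C_comp, X_comp, ← mul_assoc, ← C_mul, inv_mul_cancel₀ hl0, C_1, one_mul]
  have key : q * (a - b') = (y.comp (C l⁻¹ * X) - x).comp b' := by
    rw [← hq, sub_comp, comp_assoc, ← hb, h]
  by_cases hr : (a - b').natDegree = 0
  · rw [natDegree_eq_zero] at hr
    obtain ⟨c, hc⟩ := hr
    exact ⟨l, c, by rw [hc]; ring⟩
  exfalso
  have hr0 : a - b' ≠ 0 := by rintro h; simp [h] at hr
  have hlt : (a - b').natDegree < a.natDegree := by
    apply natDegree_lt_natDegree hr0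
    apply degree_sub_lt_left _ (by rintro rfl; simp at ha0) hlc.symm
    rw [degree_eq_natDegree (by rintro rfl; simp at ha0), degree_eq_natDegree, hdeg]
    intro h
    rw [h] at hdeg
    simp [← hdeg] at ha
  have := congrArg natDegree key
  rw [natDegree_mul hq0 hr0, natDegree_comp, hqd, hdeg] at this
  have hdvd : a.natDegree ∣ (a - b').natDegree :=
    (Nat.dvd_add_right (Dvd.intro_left _ rfl)).1 (this ▸ Dvd.intro_left _ rfl)
  exact absurd (Nat.le_of_dvd (Nat.pos_of_ne_zero hr) hdvd) (not_le.2 hlt)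

/-- The center `-p_{d-1} / (d p_d)` of a polynomial `p` of degree `d`. -/
noncomputable def polyCenter (p : ℂ[X]) : ℂ :=
  -p.coeff (p.natDegree - 1) / (p.natDegree * p.leadingCoeff)

theorem affine_symmetry {p : ℂ[X]} (hp : 2 ≤ p.natDegree) {l c l' c' : ℂ} (hl : l ≠ 0)
    (h : p.comp (C l * X + C c) = C l' * p + C c') :
    l' = l ^ p.natDegree ∧ l * polyCenter p + c = polyCenter p ∧
      ∀ i ≠ 0, (taylor (polyCenter p) p).coeff i * l ^ i =
        (taylor (polyCenter p) p).coeff i * l' := by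
  set d := p.natDegree
  set z := polyCenter p with hz
  have hp0 : p.leadingCoeff ≠ 0 := by
    rw [Ne, leadingCoeff_eq_zero]; rintro rfl; simp [d] at hp
  have hcoeff : ∀ i ≠ 0, (taylor c p).coeff i * l ^ i = p.coeff i * l' := by
    intro i hi
    rw [← comp_C_mul_X_coeff, taylor_apply, comp_assoc]
    have : (X + C c).comp (C l * X) = C l * X + C c := by simp
    rw [this, h, coeff_add, coeff_C_mul, coeff_C_of_ne_zero hi]
    ring
  have hl' : l' = l ^ d := by
    have := hcoeff d (by omega)
    have h2 : (taylor c p).coeff d = p.leadingCoeff := by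
      rw [← leadingCoeff_taylor c p, leadingCoeff, natDegree_taylor]
    rw [h2] at this
    exact (mul_left_cancel₀ hp0 this).symm
  have hfix : l * z + c = z := by
    have := hcoeff (d - 1) (by omega)
    have h2 : (taylor c p).coeff (d - 1) = p.coeff (d - 1) + d * p.leadingCoeff * c := by
      have hdd : (hasseDeriv (d - 1) p).natDegree < 2 := by
        have := natDegree_hasseDeriv_le p (d - 1)
        omega
      rw [taylor_coeff, eval_eq_sum_range' hdd, Finset.sum_range_succ, Finset.sum_range_one,
        hasseDeriv_coeff, hasseDeriv_coeff]
      have h1 : 1 + (d - 1) = d := by omega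
      have h3 : d.choose (d - 1) = d := by
        rw [Nat.choose_symm_of_eq_add (b := 1) (by omega), Nat.choose_one_right]
      rw [h1, h3]
      simp only [zero_add, Nat.choose_self, leadingCoeff]
      push_cast
      ring
    have hpow : l ^ d = l ^ (d - 1) * l := by rw [← pow_succ]; congr 1; omega
    rw [h2, hl', hpow] at this
    have hd0 : (d : ℂ) ≠ 0 := by norm_cast; omega
    have h4 : p.coeff (d - 1) + d * p.leadingCoeff * c = p.coeff (d - 1) * l := by
      apply mul_left_cancel₀ (pow_ne_zero (d - 1) hl)
      linear_combination this
    have h5 : z * (d * p.leadingCoeff) = -p.coeff (d - 1) := by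
      rw [hz, polyCenter, div_mul_cancel₀ _ (mul_ne_zero hd0 hp0)]
    apply mul_left_cancel₀ (mul_ne_zero hd0 hp0)
    linear_combination h4 + (l - 1) * h5
  refine ⟨hl', hfix, fun i hi => ?_⟩
  rw [← comp_C_mul_X_coeff, taylor_apply, comp_assoc]
  have : (X + C z).comp (C l * X) = (C l * X + C c).comp (X + C z) := by
    simp only [add_comp, mul_comp, C_comp, X_comp]
    rw [mul_add, add_assoc, ← C_mul, ← C_add, hfix]
  rw [this, ← comp_assoc, h, add_comp, mul_comp, C_comp, C_comp, coeff_add, coeff_C_mul,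
    coeff_C_of_ne_zero hi]
  ring

theorem isExceptional_of_eq_pow {p : ℂ[X]} {a z : ℂ} (hp : 2 ≤ p.natDegree) (ha : a ≠ 0)
    (h : p = C a * (X - C z) ^ p.natDegree + C z) : IsExceptional p := by
  set d := p.natDegree
  obtain ⟨α, hα⟩ := IsAlgClosed.exists_pow_nat_eq a (n := d - 1) (by omega)
  have hα0 : α ≠ 0 := by
    rintro rfl
    rw [zero_pow (by omega)] at hα
    exact ha hα.symm
  refine Or.inr ⟨α, -(α * z), hα0, Or.inl ?_⟩
  change affConj α (-(α * z)) p = X ^ d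
  rw [affConj, h]
  have h1 : (X - C z).comp (C α⁻¹ * (X - C (-(α * z)))) = C α⁻¹ * X := by
    simp only [sub_comp, X_comp, C_comp, C_neg, sub_neg_eq_add, mul_add, ← C_mul]
    rw [inv_mul_cancel_left₀ hα0]
    ring
  simp only [add_comp, mul_comp, C_comp, X_comp, pow_comp, h1]
  have h2 : α * (a * α⁻¹ ^ d) = 1 := by
    rw [← hα, inv_pow, ← mul_assoc, ← pow_succ', Nat.sub_add_cancel (by omega),
      mul_inv_cancel₀ (pow_ne_zero _ hα0)]
  calc _ = C (α * (a * α⁻¹ ^ d)) * X ^ d := by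
        simp only [C_mul, C_neg, C_pow, mul_pow]; ring
    _ = _ := by rw [h2, C_1, one_mul]

/-- The affine maps `μ` such that `p ∘ μ = μ' ∘ p` and `p ∘ μ' = μ'' ∘ p` with `μ'`, `μ''`
affine are rotations of bounded finite order about the center of `p`, unless `p` is exceptional. -/
theorem exists_pow_eq_one_of_affine_symmetry {p : ℂ[X]} (hp : ¬ IsExceptional p) :
    ∃ k : ℕ, 0 < k ∧ ∀ l c l' c' l'' c'' : ℂ, l ≠ 0 →
      p.comp (C l * X + C c) = C l' * p + C c' →
      p.comp (C l' * X + C c') = C l'' * p + C c'' →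
        l ^ k = 1 ∧ c = polyCenter p - l * polyCenter p := by
  have hd : 2 ≤ p.natDegree := by
    by_contra h
    exact hp (Or.inl (by omega))
  set z := polyCenter p with hz
  by_cases hi : ∃ i, 0 < i ∧ i < p.natDegree ∧ (taylor z p).coeff i ≠ 0
  · obtain ⟨i, hi0, hid, hi⟩ := hi
    refine ⟨p.natDegree - i, by omega, fun l c l' c' l'' c'' hl h _ => ?_⟩
    obtain ⟨h1, h2, h3⟩ := affine_symmetry hd hl h
    refine ⟨?_, by linear_combination h2⟩
    have h4 := mul_left_cancel₀ hi (h3 i hi0.ne')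
    rw [h1] at h4
    apply mul_left_cancel₀ (pow_ne_zero i hl)
    rw [← pow_add, mul_one, h4]
    congr 1
    omega
  · push Not at hi
    refine ⟨p.natDegree, by omega, fun l c l' c' l'' c'' hl h h' => ?_⟩
    obtain ⟨h1, h2, -⟩ := affine_symmetry hd hl h
    obtain ⟨-, h2', -⟩ := affine_symmetry hd (h1 ▸ pow_ne_zero _ hl) h'
    refine ⟨?_, by linear_combination h2⟩
    rw [← h1]
    have hpz : p.eval z ≠ z := by
      intro hpz
      apply hp
      apply isExceptional_of_eq_pow (a := p.leadingCoeff) (z := z) hd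
      · rw [Ne, leadingCoeff_eq_zero]; rintro rfl; simp at hd
      · have : taylor z p = C p.leadingCoeff * X ^ p.natDegree + C z := by
          ext i
          rw [coeff_add, coeff_C_mul, coeff_X_pow, coeff_C]
          rcases Nat.eq_zero_or_pos i with rfl | hi0
          · rw [taylor_coeff_zero, hpz, if_neg (by omega)]
            simp
          rcases lt_trichotomy i p.natDegree with hlt | rfl | hlt
          · rw [hi i hi0 hlt, if_neg hlt.ne, if_neg hi0.ne']
            simp
          · rw [if_pos rfl, if_neg hi0.ne', ← leadingCoeff_taylor z p, leadingCoeff,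
              natDegree_taylor]
            simp
          · rw [coeff_eq_zero_of_natDegree_lt (by rwa [natDegree_taylor]), if_neg hlt.ne',
              if_neg hi0.ne']
            simp
        have h5 := congrArg (fun q => q.comp (X - C z)) this
        simp only [taylor_apply, comp_assoc, add_comp, X_comp, C_comp, sub_add_cancel, comp_X,
          mul_comp, pow_comp] at h5
        exact h5
    have h6 := congrArg (eval z) h
    simp only [eval_comp, eval_add, eval_mul, eval_C, eval_X] at h6
    rw [h2] at h6
    have h7 : (l' - 1) * (p.eval z - z) = 0 := by linear_combination -h6 - h2'
    rcases mul_eq_zero.1 h7 with h8 | h8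
    · exact sub_eq_zero.1 h8
    · exact absurd (sub_eq_zero.1 h8) hpz

variable {S : Set ℂ[X]}

/-- Elements of `S` of equal degree differ by an affine left factor. -/
def AffineFibers (S : Set ℂ[X]) : Prop :=
  ∀ a ∈ S, ∀ b ∈ S, a.natDegree = b.natDegree → ∃ l c : ℂ, a = C l * b + C c

/-- The elements of `S` of degree `m`. -/
def fiber (S : Set ℂ[X]) (m : ℕ) : Set ℂ[X] := {p ∈ S | p.natDegree = m}

theorem AffineFibers.exists_ncard_fiber_le (hS : AffineFibers S)
    (hdeg : ∀ p ∈ S, 0 < p.natDegree) (hcomp : ∀ p ∈ S, ∀ q ∈ S, p.comp q ∈ S)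
    (hexc : ∃ P ∈ S, ¬ IsExceptional P) :
    ∃ k : ℕ, ∀ m, (fiber S m).Finite ∧ (fiber S m).ncard ≤ k := by
  obtain ⟨p, hpS, hp⟩ := hexc
  obtain ⟨k, hk, hsymm⟩ := exists_pow_eq_one_of_affine_symmetry hp
  refine ⟨k, fun m => ?_⟩
  rcases (fiber S m).eq_empty_or_nonempty with he | ⟨b, hbS, hb⟩
  · simp [he]
  let z := polyCenter p
  let F : ℂ → ℂ[X] := fun l => C l * b + C (z - l * z)
  have hsub : fiber S m ⊆ F '' (nthRootsFinset k (1 : ℂ) : Set ℂ) := by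
    rintro a ⟨haS, ha⟩
    have hb0 := hdeg b hbS
    obtain ⟨l, c, hlc⟩ := hS a haS b hbS (ha.trans hb.symm)
    have hl : l ≠ 0 := by
      rintro rfl
      have := hdeg a haS
      simp [hlc] at this
    have hpa := hcomp p hpS a haS
    have hpb := hcomp p hpS b hbS
    have hstep : ∀ q ∈ S, ∀ l c : ℂ, ∀ b ∈ S, C l * b + C c ∈ S → l ≠ 0 →
        ∃ l' c' : ℂ, q.comp (C l * X + C c) = C l' * q + C c' ∧
          q.comp (C l * b + C c) = C l' * q.comp b + C c' := by
      intro q hq l c b hb h hl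
      obtain ⟨l', c', h'⟩ := hS _ (hcomp q hq _ h) _ (hcomp q hq b hb) (by
        rw [natDegree_comp, natDegree_comp, natDegree_add_C, natDegree_C_mul hl])
      refine ⟨l', c', comp_right_cancel (hdeg b hb) ?_, h'⟩
      rw [comp_assoc]
      simpa using h'
    obtain ⟨l', c', h1, h1'⟩ := hstep p hpS l c b hbS (hlc ▸ haS) hl
    have hl' : l' ≠ 0 := by
      rintro rfl
      have := hdeg _ hpa
      rw [hlc, h1'] at this
      simp at this
    obtain ⟨l'', c'', h2, -⟩ := hstep p hpS l' c' _ hpb (h1' ▸ hlc ▸ hpa) hl'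
    obtain ⟨h3, h4⟩ := hsymm l c l' c' l'' c'' hl h1 h2
    refine ⟨l, ?_, ?_⟩
    · rw [Finset.mem_coe, mem_nthRootsFinset hk]
      exact h3
    · change C l * b + C (z - l * z) = a
      rw [hlc, h4]
  refine ⟨(Set.toFinite _).subset hsub, ?_⟩
  calc (fiber S m).ncard ≤ (F '' (nthRootsFinset k (1 : ℂ) : Set ℂ)).ncard :=
        Set.ncard_le_ncard hsub (Set.toFinite _)
    _ ≤ (nthRootsFinset k (1 : ℂ) : Set ℂ).ncard := Set.ncard_image_le (Set.toFinite _)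
    _ ≤ k := by
      rw [Set.ncard_coe_finset]
      classical
      rw [nthRootsFinset_def]
      exact (Multiset.toFinset_card_le _).trans (card_nthRoots k 1)

/-- The composition of a word in the polynomials `s i`. -/
noncomputable def wordComp {ι : Type*} (s : ι → ℂ[X]) (l : List ι) : ℂ[X] :=
  (l.map s).foldr comp X

section words

variable {ι : Type*} {s : ι → ℂ[X]}

theorem wordComp_append (l m : List ι) :
    wordComp s (l ++ m) = (wordComp s l).comp (wordComp s m) := by
  induction l with
  | nil => simp [wordComp]
  | cons i l ih =>
    simp only [wordComp, List.cons_append, List.map_cons, List.foldr_cons] at ih ⊢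
    rw [ih, comp_assoc]

theorem wordComp_singleton (i : ι) : wordComp s [i] = s i := by simp [wordComp]

theorem natDegree_wordComp (l : List ι) :
    (wordComp s l).natDegree = (l.map fun i => (s i).natDegree).prod := by
  induction l with
  | nil => simp [wordComp]
  | cons i l ih =>
    rw [← List.singleton_append, wordComp_append, natDegree_comp, wordComp_singleton, ih]
    simp

theorem wordComp_mem (hcomp : ∀ p ∈ S, ∀ q ∈ S, p.comp q ∈ S) (hs : ∀ i, s i ∈ S)
    {l : List ι} (hl : l ≠ []) : wordComp s l ∈ S := by
  induction l with
  | nil => exact absurd rfl hl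
  | cons i l ih =>
    rw [← List.singleton_append, wordComp_append, wordComp_singleton]
    rcases eq_or_ne l [] with rfl | hne
    · simpa [wordComp] using hs i
    · exact hcomp _ (hs i) _ (ih hne)

/-- If two different words of the same length in polynomials of a common positive degree are
equal, then two of these polynomials are right factors of a common polynomial. -/
theorem exists_comp_eq_comp_of_wordComp_eq {d : ℕ} (hd : 0 < d) (hs : ∀ i, (s i).natDegree = d)
    {l m : List ι} (hlen : l.length = m.length) (hne : l ≠ m)
    (h : wordComp s l = wordComp s m) :
    ∃ i j, i ≠ j ∧ ∃ x y : ℂ[X], 0 < x.natDegree ∧ 0 < y.natDegree ∧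
      x.comp (s i) = y.comp (s j) := by
  have hpos : ∀ l : List ι, 0 < (wordComp s l).natDegree := by
    intro l
    rw [natDegree_wordComp]
    simp [hs, hd]
  induction l using List.reverseRecOn generalizing m with
  | nil => exact absurd (List.length_eq_zero_iff.1 hlen.symm).symm hne
  | append_singleton l i ih =>
    rcases List.eq_nil_or_concat m with rfl | ⟨m, j, rfl⟩
    · simp at hlen
    rw [List.concat_eq_append] at *
    rw [wordComp_append, wordComp_append, wordComp_singleton, wordComp_singleton] at h
    by_cases hij : i = j
    · subst hij
      refine ih (by simpa using hlen) (fun h => hne (by rw [h])) (comp_right_cancel ?_ h)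
      rwa [hs]
    · exact ⟨i, j, hij, _, _, hpos l, hpos m, h⟩

end words

theorem affineFibers_of_not_hasFreeSG (hdeg : ∀ p ∈ S, 0 < p.natDegree)
    (h : ¬ PolyHasFreeSG S 2) : AffineFibers S := by
  intro a ha b hb hab
  rcases Nat.lt_or_ge 1 a.natDegree with hd | hd
  · unfold PolyHasFreeSG at h
    push Not at h
    obtain ⟨l, m, -, -, hlm, hne⟩ := h ![a, b] (by simp [Fin.forall_fin_two, ha, hb])
    have hs : ∀ i, (![a, b] i).natDegree = a.natDegree := by
      simp [Fin.forall_fin_two, hab]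
    have hlen : l.length = m.length := by
      have := congrArg natDegree (show wordComp ![a, b] l = wordComp ![a, b] m from hlm)
      rw [natDegree_wordComp, natDegree_wordComp] at this
      simp only [hs, List.map_const', List.prod_replicate] at this
      exact Nat.pow_right_injective hd this
    obtain ⟨i, j, hij, x, y, hx, hy, hxy⟩ :=
      exists_comp_eq_comp_of_wordComp_eq (hdeg a ha) hs hlen hne hlm
    have : ∃ x y : ℂ[X], 0 < x.natDegree ∧ x.comp a = y.comp b := by
      fin_cases i <;> fin_cases j
      · exact absurd rfl hij
      · exact ⟨x, y, hx, hxy⟩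
      · exact ⟨y, x, hy, hxy.symm⟩
      · exact absurd rfl hij
    obtain ⟨x, y, hx, hxy⟩ := this
    exact exists_affine_of_comp_eq_comp hx (hdeg a ha) hab hxy
  · have ha1 : a.natDegree = 1 := le_antisymm hd (hdeg a ha)
    obtain ⟨u, hu, v, rfl⟩ := natDegree_eq_one.1 ha1
    obtain ⟨u', hu', v', rfl⟩ := natDegree_eq_one.1 (hab ▸ ha1)
    refine ⟨u / u', v - u / u' * v', ?_⟩
    rw [mul_add, ← mul_assoc, ← C_mul, ← C_mul, div_mul_cancel₀ _ hu', add_assoc, ← C_add]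
    ring_nf

theorem not_hasFreeSG_of_ncard_fiber_le (hcomp : ∀ p ∈ S, ∀ q ∈ S, p.comp q ∈ S) {k : ℕ}
    (hk : ∀ m, (fiber S m).Finite ∧ (fiber S m).ncard ≤ k) : ¬ PolyHasFreeSG S 2 := by
  rintro ⟨s, hs, hfree⟩
  let w : ℕ → List (Fin 2) := fun i => List.replicate i 0 ++ [1] ++ List.replicate (k - i) 0
  have hw : ∀ i, w i ≠ [] := by simp [w]
  have hinj : Function.Injective w := by
    intro i j hij
    have h1 := congrArg (fun l => l.idxOf 1) hij
    have h2 : ∀ i, (w i).idxOf 1 = i := by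
      intro i
      simp only [w]
      rw [List.append_assoc, List.idxOf_append_of_notMem (by simp [List.mem_replicate])]
      simp
    simpa [h2] using h1
  let m := (s 0).natDegree ^ k * (s 1).natDegree
  have hmem : ∀ i ∈ Finset.range (k + 1), wordComp s (w i) ∈ fiber S m := by
    intro i hi
    refine ⟨wordComp_mem hcomp hs (hw i), ?_⟩
    rw [Finset.mem_range] at hi
    have : k = i + (k - i) := by omega
    rw [natDegree_wordComp]
    simp only [w, m, List.map_append, List.map_replicate, List.prod_append, List.prod_replicate,
      List.map_cons, List.map_nil, List.prod_singleton]
    conv_rhs => rw [this, pow_add]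
    ring
  have hle : (Finset.range (k + 1)).card ≤ (hk m).1.toFinset.card := by
    refine Finset.card_le_card_of_injOn (fun i => wordComp s (w i)) ?_ ?_
    · intro i hi
      simpa using hmem i hi
    · intro i _ j _ hij
      exact hinj (hfree _ _ (hw i) (hw j) hij)
  rw [Finset.card_range, ← Set.ncard_eq_toFinset_card _ (hk m).1] at hle
  have := (hk m).2
  omega

theorem leftCancellative_of_ncard_fiber_le (hdeg : ∀ p ∈ S, 0 < p.natDegree)
    (hcomp : ∀ p ∈ S, ∀ q ∈ S, p.comp q ∈ S) {k : ℕ}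
    (hk : ∀ m, (fiber S m).Finite ∧ (fiber S m).ncard ≤ k)
    (hrev : ∀ a ∈ S, ∀ b ∈ S, ∃ x ∈ S, ∃ y ∈ S, a.comp x = b.comp y) :
    PolyLeftCancellative S := by
  intro a ha b hb c hc habc
  by_contra hbc
  have hright : ∀ m, ∀ h ∈ S, (fun g : ℂ[X] => g.comp h) '' fiber S m ⊆
      fiber S (m * h.natDegree) ∧
      ((fun g : ℂ[X] => g.comp h) '' fiber S m).ncard = (fiber S m).ncard := by
    intro m h hh
    refine ⟨?_, Set.ncard_image_of_injective _ fun g g' => comp_right_cancel (hdeg h hh)⟩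
    rintro _ ⟨g, ⟨hg, hgm⟩, rfl⟩
    exact ⟨hcomp g hg h hh, by rw [natDegree_comp, hgm]⟩
  obtain ⟨g₀, hg₀, hmax⟩ : ∃ g₀ ∈ S, ∀ g ∈ S,
      (fiber S g.natDegree).ncard ≤ (fiber S g₀.natDegree).ncard := by
    have hfin : ((fun g : ℂ[X] => (fiber S g.natDegree).ncard) '' S).Finite :=
      (Set.finite_Iic k).subset (by rintro _ ⟨g, -, rfl⟩; exact (hk _).2)
    obtain ⟨_, ⟨g₀, hg₀, rfl⟩, h⟩ := hfin.exists_maximal ⟨_, a, ha, rfl⟩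
    refine ⟨g₀, hg₀, fun g hg => ?_⟩
    by_contra! hlt
    exact absurd (h ⟨g, hg, rfl⟩ hlt.le) (not_le.2 hlt)
  set N := (fiber S g₀.natDegree).ncard
  have hmaxN : ∀ g ∈ S, (fiber S (g₀.natDegree * g.natDegree)).ncard = N := by
    intro g hg
    apply le_antisymm
    · rw [← natDegree_comp]
      exact hmax _ (hcomp _ hg₀ _ hg)
    · obtain ⟨h1, h2⟩ := hright g₀.natDegree g hg
      exact h2.symm.le.trans (Set.ncard_le_ncard h1 (hk _).1)
  set n := g₀.natDegree * b.natDegree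
  have hcard : ∀ g ∈ S, (fiber S (n * g.natDegree)).ncard = N := by
    intro g hg
    rw [mul_assoc, ← natDegree_comp]
    exact hmaxN _ (hcomp b hb g hg)
  have hbc_deg : b.natDegree = c.natDegree := by
    have := congrArg natDegree habc
    rw [natDegree_comp, natDegree_comp] at this
    exact Nat.eq_of_mul_eq_mul_left (hdeg a ha) this
  have hbg : b.comp g₀ ∈ fiber S n := ⟨hcomp b hb g₀ hg₀, by rw [natDegree_comp, mul_comm]⟩
  have hcg : c.comp g₀ ∈ fiber S n :=
    ⟨hcomp c hc g₀ hg₀, by rw [natDegree_comp, mul_comm, ← hbc_deg]⟩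
  obtain ⟨f, ⟨hfS, hf⟩, hfa⟩ : ∃ f ∈ fiber S (n * a.natDegree),
      f ∉ (fun g : ℂ[X] => a.comp g) '' fiber S n := by
    by_contra! hsub
    have hge : (fiber S n).ncard ≤ ((fun g : ℂ[X] => a.comp g) '' fiber S n).ncard := by
      rw [hmaxN b hb, ← hcard a ha]
      exact Set.ncard_le_ncard hsub ((hk _).1.image _)
    have hinj := Set.injOn_of_ncard_image_eq (le_antisymm (Set.ncard_image_le (hk n).1) hge)
      (hk n).1
    refine hbc (comp_right_cancel (hdeg g₀ hg₀) (hinj hbg hcg ?_))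
    simp only [← comp_assoc, habc]
  obtain ⟨x, hx, y, hy, hxy⟩ := hrev f hfS _ (hcomp a ha _ hbg.1)
  have hxy_deg : x.natDegree = y.natDegree := by
    have := congrArg natDegree hxy
    rw [natDegree_comp, natDegree_comp, natDegree_comp (p := a), hf, hbg.2, mul_comm a.natDegree] at this
    exact Nat.eq_of_mul_eq_mul_left (mul_pos (mul_pos (hdeg _ hg₀) (hdeg _ hb)) (hdeg _ ha)) this
  have heq : (fun g : ℂ[X] => g.comp x) '' fiber S n = fiber S (n * x.natDegree) := by
    obtain ⟨h1, h2⟩ := hright n x hx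
    refine Set.eq_of_subset_of_ncard_le h1 ?_ (hk _).1
    rw [h2, hcard x hx, hmaxN b hb]
  have hmem : (b.comp g₀).comp y ∈ fiber S (n * x.natDegree) :=
    ⟨hcomp _ hbg.1 _ hy, by rw [natDegree_comp, hbg.2, hxy_deg]⟩
  rw [← heq] at hmem
  obtain ⟨g', hg', hg'x⟩ := hmem
  refine hfa ⟨g', hg', comp_right_cancel (hdeg x hx) ?_⟩
  simp only at hg'x ⊢
  rw [hxy, comp_assoc, hg'x, ← comp_assoc]

section means

open Filter Topology

variable {σ : Type*}

theorem abs_average_le {f : σ → ℝ} {K : ℝ} (hf : ∀ s, |f s| ≤ K) {F : Finset σ}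
    (hF : F.Nonempty) : |(∑ x ∈ F, f x) / F.card| ≤ K := by
  have hc : (0 : ℝ) < F.card := by exact_mod_cast hF.card_pos
  rw [abs_div, abs_of_pos hc, div_le_iff₀ hc]
  calc |∑ x ∈ F, f x| ≤ ∑ x ∈ F, |f x| := Finset.abs_sum_le_sum_abs _ _
    _ ≤ ∑ _x ∈ F, K := Finset.sum_le_sum fun x _ => hf x
    _ = K * F.card := by simp [mul_comm]

/-- The mean obtained as a limit of averages over finite sets along an ultrafilter. -/
noncomputable def ultraMean {ι : Type*} (U : Ultrafilter ι) (F : ι → Finset σ) (f : σ → ℝ) : ℝ :=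
  limUnder (U : Filter ι) fun i => (∑ x ∈ F i, f x) / ((F i).card : ℝ)

theorem tendsto_ultraMean {ι : Type*} (U : Ultrafilter ι) {F : ι → Finset σ}
    (hF : ∀ i, (F i).Nonempty) {f : σ → ℝ} (hf : Bdd f) :
    Tendsto (fun i => (∑ x ∈ F i, f x) / ((F i).card : ℝ)) U (𝓝 (ultraMean U F f)) := by
  obtain ⟨K, hK⟩ := hf
  apply tendsto_nhds_limUnder
  obtain ⟨x, -, hx⟩ := isCompact_iff_ultrafilter_le_nhds.1 (isCompact_Icc (a := -K) (b := K))
    (U.map fun i => (∑ x ∈ F i, f x) / ((F i).card : ℝ)) (by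
      rw [le_principal_iff]
      exact Filter.mem_map.2 (Filter.univ_mem' fun i => abs_le.1 (abs_average_le hK (hF i))))
  exact ⟨x, hx⟩

/-- A family of self-maps with approximately invariant finite sets admits an invariant mean. -/
theorem exists_mean_of_folner (T : Set (σ → σ))
    (hT : ∀ H : Finset (σ → σ), ↑H ⊆ T → ∀ ε > 0, ∃ F F' : Finset σ, F.Nonempty ∧ F ⊆ F' ∧
      (F'.card : ℝ) ≤ (1 + ε) * F.card ∧
        ∀ t ∈ H, Set.InjOn t F ∧ ∀ x ∈ F, t x ∈ F') :
    ∃ M : Mean σ, ∀ t ∈ T, ∀ f : σ → ℝ, Bdd f → M.toFun (f ∘ t) = M.toFun f := by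
  classical
  choose F F' hF hFF' hcard hmap using fun i : Finset T × ℕ =>
    hT (i.1.map (Function.Embedding.subtype _)) (by simp) (1 / ((i.2 : ℝ) + 1)) (by positivity)
  let U : Ultrafilter (Finset T × ℕ) := Ultrafilter.of atTop
  have hU : (U : Filter (Finset T × ℕ)) ≤ atTop := Ultrafilter.of_le atTop
  have hlim := fun f : σ → ℝ => tendsto_ultraMean U hF (f := f)
  have hpos : ∀ i, (0 : ℝ) < (F i).card := fun i => by exact_mod_cast (hF i).card_pos
  have hadd : ∀ f g : σ → ℝ, Bdd f → Bdd g → Bdd (f + g) := by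
    rintro f g ⟨K, hK⟩ ⟨L, hL⟩
    exact ⟨K + L, fun s => (abs_add_le _ _).trans (add_le_add (hK s) (hL s))⟩
  have hsmul : ∀ (c : ℝ) (f : σ → ℝ), Bdd f → Bdd (c • f) := by
    rintro c f ⟨K, hK⟩
    refine ⟨|c| * K, fun s => ?_⟩
    rw [Pi.smul_apply, smul_eq_mul, abs_mul]
    exact mul_le_mul_of_nonneg_left (hK s) (abs_nonneg c)
  let M : Mean σ :=
    { toFun := ultraMean U F
      map_add' := fun f g hf hg => by
        refine tendsto_nhds_unique (hlim _ (hadd f g hf hg)) ?_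
        refine ((hlim f hf).add (hlim g hg)).congr fun i => ?_
        simp only [Pi.add_apply, Finset.sum_add_distrib, add_div]
      map_smul' := fun c f hf => by
        refine tendsto_nhds_unique (hlim _ (hsmul c f hf)) ?_
        refine ((hlim f hf).const_mul c).congr fun i => ?_
        simp only [Pi.smul_apply, smul_eq_mul, ← Finset.mul_sum, mul_div_assoc]
      nonneg' := fun f hf h0 => by
        refine ge_of_tendsto' (hlim f hf) fun i => ?_
        exact div_nonneg (Finset.sum_nonneg fun x _ => h0 x) (hpos i).le
      one' := by
        refine tendsto_nhds_unique (hlim _ ⟨1, by simp⟩) (tendsto_const_nhds.congr fun i => ?_)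
        simp [(hpos i).ne'] }
  refine ⟨M, fun t ht f hf => ?_⟩
  obtain ⟨K, hK⟩ := hf
  have hlim1 := hlim (f ∘ t) ⟨K, fun s => hK (t s)⟩
  have hlim2 := hlim f ⟨K, hK⟩
  rw [← sub_eq_zero]
  refine tendsto_nhds_unique (hlim1.sub hlim2) ?_
  refine squeeze_zero_norm' (a := fun i : Finset T × ℕ => 2 * K * (1 / ((i.2 : ℝ) + 1))) ?_ ?_
  · have hev : ∀ᶠ i : Finset T × ℕ in atTop, (⟨t, ht⟩ : T) ∈ i.1 := by
      filter_upwards [eventually_ge_atTop (({⟨t, ht⟩}, 0) : Finset T × ℕ)] with i hi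
      exact hi.1 (Finset.mem_singleton_self _)
    filter_upwards [hU hev] with i hi
    obtain ⟨hinj, hsub⟩ := hmap i t (by simpa using ⟨ht, hi⟩)
    have himg : (F i).image t ⊆ F' i := by
      intro y hy
      obtain ⟨x, hx, rfl⟩ := Finset.mem_image.1 hy
      exact hsub x hx
    have hbound : ∀ G : Finset σ, G ⊆ F' i → G.card = (F i).card →
        |∑ x ∈ F' i, f x - ∑ x ∈ G, f x| ≤ K * (1 / ((i.2 : ℝ) + 1) * (F i).card) := by
      intro G hG hGc
      rw [← Finset.sum_sdiff_eq_sub hG]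
      have hK0 : 0 ≤ K := (abs_nonneg _).trans (hK (hF i).choose)
      calc |∑ x ∈ F' i \ G, f x| ≤ ∑ x ∈ F' i \ G, |f x| := Finset.abs_sum_le_sum_abs _ _
        _ ≤ ∑ _x ∈ F' i \ G, K := Finset.sum_le_sum fun x _ => hK x
        _ = K * (F' i \ G).card := by simp [mul_comm]
        _ ≤ _ := by
          gcongr
          rw [Finset.cast_card_sdiff hG, hGc]
          linarith [hcard i]
    have h1 := hbound _ (hFF' i) rfl
    have h2 := hbound _ himg (Finset.card_image_of_injOn hinj)
    rw [Finset.sum_image hinj] at h2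
    rw [← sub_div, norm_div, Real.norm_eq_abs, Real.norm_eq_abs, abs_of_pos (hpos i),
      div_le_iff₀ (hpos i)]
    simp only [Function.comp_apply]
    rw [abs_le] at h1 h2 ⊢
    constructor <;> linarith
  · have h0 : Tendsto (fun i : Finset T × ℕ => 2 * K * (1 / ((i.2 : ℝ) + 1))) atTop
        (𝓝 (2 * K * 0)) :=
      (tendsto_one_div_add_atTop_nhds_zero_nat.comp
        (tendsto_snd.comp (prod_atTop_atTop_eq (α := Finset T) (β := ℕ)).ge)).const_mul _
    rw [mul_zero] at h0
    exact h0.mono_left hU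

/-- Two self-maps leaving a mean invariant have intersecting ranges. -/
theorem exists_eq_of_invariant_mean (M : Mean σ) {t u : σ → σ}
    (ht : ∀ f : σ → ℝ, Bdd f → M.toFun (f ∘ t) = M.toFun f)
    (hu : ∀ f : σ → ℝ, Bdd f → M.toFun (f ∘ u) = M.toFun f) : ∃ x y, t x = u y := by
  classical
  by_contra! h
  have hb : ∀ A : Set σ, Bdd (A.indicator (1 : σ → ℝ)) := fun A =>
    ⟨1, fun s => by by_cases hs : s ∈ A <;> simp [hs]⟩
  have hr : ∀ v : σ → σ, (∀ f : σ → ℝ, Bdd f → M.toFun (f ∘ v) = M.toFun f) →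
      M.toFun ((Set.range v).indicator 1) = 1 := by
    intro v hv
    rw [← hv _ (hb _), ← M.one']
    congr 1
    ext x
    simp
  have hdisj : Disjoint (Set.range t) (Set.range u) := by
    rw [Set.disjoint_left]
    rintro _ ⟨x, rfl⟩ ⟨y, hy⟩
    exact h x y hy.symm
  have hunion := M.map_add' _ _ (hb (Set.range t)) (hb (Set.range u))
  have hind : (Set.range t).indicator (1 : σ → ℝ) + (Set.range u).indicator 1 =
      (Set.range t ∪ Set.range u).indicator 1 :=
    (Set.indicator_union_of_disjoint hdisj (1 : σ → ℝ)).symm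
  rw [hind, hr t ht, hr u hu] at hunion
  have hcompl := M.map_add' _ _ (hb (Set.range t ∪ Set.range u)) (hb (Set.range t ∪ Set.range u)ᶜ)
  rw [Set.indicator_self_add_compl, hunion] at hcompl
  have hnonneg := M.nonneg' _ (hb (Set.range t ∪ Set.range u)ᶜ)
    (Set.indicator_nonneg fun _ _ => zero_le_one)
  have hone : M.toFun (1 : σ → ℝ) = 1 := M.one'
  linarith

end means

/-- If the degree-like function `deg` has uniformly bounded fibers, then there are finite sets
almost invariant under all maps multiplying `deg` by elements of a given finite set. -/
theorem exists_folner_of_bounded_fibers {σ : Type*} (deg : σ → ℕ) {k : ℕ}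
    (hk : ∀ m, ∃ G : Finset σ, (∀ x, x ∈ G ↔ deg x = m) ∧ G.card ≤ k) (x₀ : σ) (H : Finset ℕ)
    {ε : ℝ} (hε : 0 < ε) :
    ∃ F F' : Finset σ, F.Nonempty ∧ F ⊆ F' ∧ (F'.card : ℝ) ≤ (1 + ε) * F.card ∧
      ∀ x ∈ F, ∀ m ∈ H, ∀ y, deg y = m * deg x → y ∈ F' := by
  classical
  choose G hG hGk using hk
  let φ : (H → ℕ) → ℕ := fun e => deg x₀ * ∏ h : H, (h : ℕ) ^ e h
  let E : ℕ → Finset (H → ℕ) := fun n => Fintype.piFinset fun _ => Finset.range (n + 1)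
  let F : ℕ → Finset σ := fun n => ((E n).image φ).biUnion G
  have hmemF : ∀ n x, x ∈ F n ↔ ∃ e : H → ℕ, (∀ h, e h < n + 1) ∧ φ e = deg x := by
    intro n x
    simp [F, E, hG, eq_comm]
  have hmono : ∀ n, F n ⊆ F (n + 1) := by
    intro n x
    rw [hmemF, hmemF]
    rintro ⟨e, he, hx⟩
    exact ⟨e, fun h => (he h).trans (Nat.lt_succ_self _), hx⟩
  have hne : ∀ n, (F n).Nonempty := fun n => ⟨x₀, (hmemF n x₀).2 ⟨0, by simp, by simp [φ]⟩⟩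
  have hcard : ∀ n, (F n).card ≤ (n + 1) ^ H.card * k := by
    intro n
    calc (F n).card ≤ ((E n).image φ).card * k :=
          Finset.card_biUnion_le_card_mul _ _ _ fun m _ => hGk m
      _ ≤ (E n).card * k := Nat.mul_le_mul_right _ Finset.card_image_le
      _ = _ := by simp [E]
  obtain ⟨n, hn⟩ : ∃ n, ((F (n + 1)).card : ℝ) ≤ (1 + ε) * (F n).card := by
    by_contra! hlt
    have hpow : ∀ n, (1 + ε) ^ n ≤ ((F n).card : ℝ) := by
      intro n
      induction n with
      | zero => simpa using (hne 0).card_pos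
      | succ n ih =>
        rw [pow_succ']
        exact (mul_le_mul_of_nonneg_left ih (by linarith)).trans (hlt n).le
    have hlim := tendsto_pow_const_div_const_pow_of_one_lt H.card (r := 1 + ε) (by linarith)
    have hδ : 0 < 1 / (((k : ℝ) + 1) * (1 + ε)) := by positivity
    obtain ⟨N, hN⟩ := Filter.eventually_atTop.1 (hlim.eventually (gt_mem_nhds hδ))
    have h1 := hN (N + 1) (Nat.le_succ N)
    rw [div_lt_div_iff₀ (by positivity) (by positivity), one_mul, pow_succ,
      ← mul_assoc] at h1
    have h2 := lt_of_mul_lt_mul_right h1 (by linarith)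
    have h3 : ((F N).card : ℝ) ≤ ((N + 1 : ℕ) : ℝ) ^ H.card * k := by exact_mod_cast hcard N
    have h4 := hpow N
    have h5 : (0 : ℝ) ≤ ((N + 1 : ℕ) : ℝ) ^ H.card := by positivity
    linarith
  refine ⟨F n, F (n + 1), hne n, hmono n, hn, fun x hx m hm y hy => ?_⟩
  rw [hmemF] at hx ⊢
  obtain ⟨e, he, hex⟩ := hx
  refine ⟨fun j => e j + if j = ⟨m, hm⟩ then 1 else 0, fun j => ?_, ?_⟩
  · have := he j
    dsimp only
    split_ifs <;> omega
  · simp only [φ, pow_add, Finset.prod_mul_distrib] at hex ⊢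
    rw [← mul_assoc, hex, hy, mul_comm]
    congr 1
    simp

theorem exists_invariant_mean (hne : S.Nonempty) (hdeg : ∀ p ∈ S, 0 < p.natDegree)
    (hcomp : ∀ p ∈ S, ∀ q ∈ S, p.comp q ∈ S) (hcancel : PolyLeftCancellative S) {k : ℕ}
    (hk : ∀ m, (fiber S m).Finite ∧ (fiber S m).ncard ≤ k) :
    ∃ M : Mean S, PolyLeftInv S M ∧ PolyRightInv S M := by
  classical
  obtain ⟨p₀, hp₀⟩ := hne
  let L : S → S → S := fun h g => ⟨(h : ℂ[X]).comp g, hcomp _ h.2 _ g.2⟩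
  let R : S → S → S := fun h g => ⟨(g : ℂ[X]).comp h, hcomp _ g.2 _ h.2⟩
  have hfib : ∀ m, ∃ G : Finset S, (∀ x, x ∈ G ↔ (x : ℂ[X]).natDegree = m) ∧ G.card ≤ k := by
    intro m
    refine ⟨(hk m).1.toFinset.subtype (· ∈ S), fun x => by simp [fiber], ?_⟩
    rw [Finset.card_subtype]
    refine (Finset.card_filter_le _ _).trans ?_
    rw [← Set.ncard_eq_toFinset_card _ (hk m).1]
    exact (hk m).2
  have hT : ∀ t ∈ Set.range L ∪ Set.range R, Function.Injective t ∧
      ∃ m, ∀ g, (t g : ℂ[X]).natDegree = m * (g : ℂ[X]).natDegree := by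
    rintro _ (⟨h, rfl⟩ | ⟨h, rfl⟩)
    · refine ⟨fun x y hxy => ?_, (h : ℂ[X]).natDegree, fun g => natDegree_comp⟩
      exact Subtype.ext (hcancel _ h.2 _ x.2 _ y.2 (congrArg Subtype.val hxy))
    · refine ⟨fun x y hxy => ?_, (h : ℂ[X]).natDegree, fun g => ?_⟩
      · exact Subtype.ext (comp_right_cancel (hdeg _ h.2) (congrArg Subtype.val hxy))
      · rw [mul_comm]
        exact natDegree_comp
  obtain ⟨M, hM⟩ := exists_mean_of_folner (Set.range L ∪ Set.range R) (by
    intro H hH ε hε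
    choose! m hm using fun t ht => (hT t ht).2
    obtain ⟨F, F', h1, h2, h3, h4⟩ := exists_folner_of_bounded_fibers
      (fun p : S => (p : ℂ[X]).natDegree) hfib ⟨p₀, hp₀⟩ (H.image m) hε
    refine ⟨F, F', h1, h2, h3, fun t ht => ⟨(hT t (hH ht)).1.injOn, fun x hx => ?_⟩⟩
    exact h4 x hx (m t) (Finset.mem_image_of_mem m ht) _ (hm t (hH ht) x))
  exact ⟨M, fun h _ f hf => hM (L h) (Or.inl ⟨h, rfl⟩) f hf,
    fun h _ f hf => hM (R h) (Or.inr ⟨h, rfl⟩) f hf⟩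

theorem exists_comp_eq_comp_of_leftInv (hcomp : ∀ p ∈ S, ∀ q ∈ S, p.comp q ∈ S) {M : Mean S}
    (hM : PolyLeftInv S M) : ∀ a ∈ S, ∀ b ∈ S, ∃ x ∈ S, ∃ y ∈ S, a.comp x = b.comp y := by
  intro a ha b hb
  obtain ⟨x, y, hxy⟩ := exists_eq_of_invariant_mean M
    (hM ⟨a, ha⟩ fun g => hcomp a ha g g.2) (hM ⟨b, hb⟩ fun g => hcomp b hb g g.2)
  exact ⟨x, x.2, y, y.2, congrArg Subtype.val hxy⟩

theorem affineFibers_of_rightInv (hdeg : ∀ p ∈ S, 0 < p.natDegree)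
    (hcomp : ∀ p ∈ S, ∀ q ∈ S, p.comp q ∈ S) {M : Mean S} (hM : PolyRightInv S M) :
    AffineFibers S := by
  intro a ha b hb hab
  obtain ⟨x, y, hxy⟩ := exists_eq_of_invariant_mean M
    (hM ⟨a, ha⟩ fun g => hcomp g g.2 a ha) (hM ⟨b, hb⟩ fun g => hcomp g g.2 b hb)
  exact exists_affine_of_comp_eq_comp (hdeg x x.2) (hdeg a ha) hab (congrArg Subtype.val hxy)

end PolySemigroup

/-- A non-exceptional semigroup of (nonconstant complex) polynomials is amenable if
and only if it contains no free subsemigroup of rank 2 and is cancellative. -/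
theorem amenable_iff_no_free_and_cancellative
    (S : Set (Polynomial ℂ)) (hne : S.Nonempty)
    (hdeg : ∀ p ∈ S, 0 < p.natDegree)
    (hcomp : ∀ p ∈ S, ∀ q ∈ S, p.comp q ∈ S)
    (hexc : ∃ P ∈ S, ¬ IsExceptional P) :
    (∃ M : Mean S, PolyLeftInv S M ∧ PolyRightInv S M) ↔
      (¬ PolyHasFreeSG S 2 ∧ PolyCancellative S) := by
  constructor
  · rintro ⟨M, hL, hR⟩
    obtain ⟨k, hk⟩ := (PolySemigroup.affineFibers_of_rightInv hdeg hcomp hR).exists_ncard_fiber_le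
      hdeg hcomp hexc
    exact ⟨PolySemigroup.not_hasFreeSG_of_ncard_fiber_le hcomp hk,
      PolySemigroup.leftCancellative_of_ncard_fiber_le hdeg hcomp hk
        (PolySemigroup.exists_comp_eq_comp_of_leftInv hcomp hL),
      fun a ha b _ c _ h => PolySemigroup.comp_right_cancel (hdeg a ha) h⟩
  · rintro ⟨hfree, hcancel, -⟩
    obtain ⟨k, hk⟩ :=
      (PolySemigroup.affineFibers_of_not_hasFreeSG hdeg hfree).exists_ncard_fiber_le hdeg hcomp hexc
    exact PolySemigroup.exists_invariant_mean hne hdeg hcomp hcancel hk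
end

section
/- Let S be a non-exceptional semigroup of polynomials that is right amenable and left cancellative. Then S is amenable. -/
namespace Polynomial

theorem comp_left_injective {R : Type*} [CommRing R] [IsDomain R] {q : R[X]}
    (hq : 0 < q.natDegree) : Function.Injective fun p : R[X] => p.comp q := by
  intro p₁ p₂ h
  have h0 : (p₁ - p₂).comp q = 0 := by simpa [sub_comp, sub_eq_zero] using h
  rcases comp_eq_zero_iff.1 h0 with h1 | ⟨-, h1⟩
  · exact sub_eq_zero.1 h1
  · rw [h1, natDegree_C] at hq
    exact absurd hq (lt_irrefl 0)

theorem iterate_derivative_comp_linear {R : Type*} [CommRing R] (p : R[X]) (l c : R) (k : ℕ) :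
    derivative^[k] (p.comp (C l * X + C c)) =
      C (l ^ k) * (derivative^[k] p).comp (C l * X + C c) := by
  induction k generalizing p with
  | zero => simp
  | succ k ih =>
    simp only [Function.iterate_succ_apply, derivative_comp, derivative_add, derivative_mul,
      derivative_C, derivative_X, zero_mul, mul_one, zero_add, add_zero,
      iterate_derivative_C_mul, ih, ← mul_assoc, ← C_mul, pow_succ']

/-- The unique root of the `(deg p - 1)`-st derivative of `p` is fixed by every affine map `L`
such that `p ∘ L` is an affine function of `p`. -/
theorem exists_fixedPoint_of_comp_linear {K : Type*} [Field K] [CharZero K] {p : K[X]}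
    (hp : 2 ≤ p.natDegree) :
    ∃ z : K, ∀ l c m d : K, l ≠ 0 → p.comp (C l * X + C c) = C m * p + C d → l * z + c = z := by
  set q := derivative^[p.natDegree - 1] p with hq
  have hq1 : q.natDegree ≤ 1 := (natDegree_iterate_derivative _ _).trans (by omega)
  have hu : q.coeff 1 ≠ 0 := by
    rw [hq, coeff_iterate_derivative, show 1 + (p.natDegree - 1) = p.natDegree by omega,
      nsmul_eq_mul]
    refine mul_ne_zero (Nat.cast_ne_zero.2 ?_) (leadingCoeff_ne_zero.2 ?_)
    · exact (Nat.descFactorial_pos.2 (by omega)).ne'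
    · rintro rfl
      simp at hp
  have hqe (w : K) : q.eval w = q.coeff 1 * w + q.coeff 0 := by
    conv_lhs => rw [eq_X_add_C_of_natDegree_le_one hq1]
    simp
  refine ⟨-q.coeff 0 / q.coeff 1, fun l c m d hl h => ?_⟩
  set z := -q.coeff 0 / q.coeff 1 with hz
  have hqz : q.eval z = 0 := by rw [hqe, hz]; field_simp; ring
  have h' : C (l ^ (p.natDegree - 1)) * q.comp (C l * X + C c) = C m * q := by
    rw [hq, ← iterate_derivative_comp_linear, h, iterate_map_add,
      iterate_derivative_C_mul, iterate_derivative_C (by omega), add_zero]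
  have h0 := congrArg (eval z) h'
  simp only [eval_mul, eval_C, eval_comp, eval_add, eval_X, hqz, mul_zero, mul_eq_zero,
    pow_ne_zero _ hl, false_or] at h0
  rw [hqe] at h0 hqz
  exact mul_left_cancel₀ hu (add_right_cancel (h0.trans hqz.symm))

/-- Polynomials `a`, `b` of the same degree with a common left composite by polynomials of the
same degree are affinely related. -/
theorem exists_affine_of_comp_eq_comp {K : Type*} [Field K] [CharZero K] {x y a b : K[X]}
    (ha : 0 < a.natDegree) (hab : a.natDegree = b.natDegree) (hx : 0 < x.natDegree)
    (h : x.comp a = y.comp b) : ∃ l c : K, l ≠ 0 ∧ a = C l * b + C c := by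
  have hxy : x.natDegree = y.natDegree := by
    have h1 := congrArg natDegree h
    rw [natDegree_comp, natDegree_comp, ← hab] at h1
    exact Nat.eq_of_mul_eq_mul_right ha h1
  have ha0 : a.leadingCoeff ≠ 0 := leadingCoeff_ne_zero.2 fun h => by simp [h] at ha
  have hb0 : b.leadingCoeff ≠ 0 := leadingCoeff_ne_zero.2 fun h => by simp [hab, h] at ha
  have hx0 : x.leadingCoeff ≠ 0 := leadingCoeff_ne_zero.2 fun h => by simp [h] at hx
  set l := a.leadingCoeff / b.leadingCoeff with hl
  have hl0 : l ≠ 0 := div_ne_zero ha0 hb0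
  set m := a.natDegree with hm
  set n := x.natDegree with hn
  set b' := C l * b with hb'
  have hb'm : b'.natDegree ≤ m := (natDegree_C_mul_le _ _).trans hab.ge
  have hb'c : b'.coeff m = a.leadingCoeff := by
    rw [hb', coeff_C_mul, hab, coeff_natDegree, hl, div_mul_cancel₀ _ hb0]
  suffices h0 : (a - b').natDegree = 0 by
    refine ⟨l, (a - b').coeff 0, hl0, ?_⟩
    rw [← eq_C_of_natDegree_eq_zero h0]
    ring
  by_contra hne
  have he : a - b' ≠ 0 := fun h => hne (by rw [h, natDegree_zero])
  have hlc : y.leadingCoeff = x.leadingCoeff * l ^ n := by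
    have h1 := congrArg leadingCoeff h
    rw [leadingCoeff_comp ha.ne', leadingCoeff_comp (hab ▸ ha.ne'), ← hxy] at h1
    rw [hl, div_pow, ← mul_div_assoc, h1, mul_div_cancel_right₀ _ (pow_ne_zero _ hb0)]
  have hxa : x.comp a = x.eraseLead.comp a + C x.leadingCoeff * a ^ n := by
    have h1 := congrArg (fun p => p.comp a) (eraseLead_add_C_mul_X_pow x)
    simp only [add_comp, mul_comp, C_comp, pow_comp, X_comp] at h1
    rw [hn, h1]
  have hyb : y.comp b = y.eraseLead.comp b + C y.leadingCoeff * b ^ n := by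
    have h1 := congrArg (fun p => p.comp b) (eraseLead_add_C_mul_X_pow y)
    simp only [add_comp, mul_comp, C_comp, pow_comp, X_comp] at h1
    rw [hxy, h1]
  have key : C x.leadingCoeff * (a ^ n - b' ^ n) = y.eraseLead.comp b - x.eraseLead.comp a := by
    rw [hxa, hyb, hlc, C_mul, C_pow] at h
    rw [hb', mul_pow]
    linear_combination h
  have hdeg : (a ^ n - b' ^ n).natDegree ≤ (n - 1) * m := by
    rw [← natDegree_C_mul hx0, key]
    refine (natDegree_sub_le _ _).trans (max_le ?_ ?_)
    · rw [natDegree_comp, ← hab]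
      exact Nat.mul_le_mul_right _ (hxy ▸ eraseLead_natDegree_le y)
    · rw [natDegree_comp]
      exact Nat.mul_le_mul_right _ (eraseLead_natDegree_le x)
  have hG : (∑ i ∈ Finset.range n, a ^ i * b' ^ (n - 1 - i)).coeff ((n - 1) * m) ≠ 0 := by
    have : ∀ i ∈ Finset.range n, (a ^ i * b' ^ (n - 1 - i)).coeff ((n - 1) * m) =
        a.leadingCoeff ^ (n - 1) := by
      intro i hi
      have hi' : i + (n - 1 - i) = n - 1 := by have := Finset.mem_range.1 hi; omega
      rw [show (n - 1) * m = i * m + (n - 1 - i) * m by rw [← add_mul, hi'],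
        coeff_mul_add_eq_of_natDegree_le (natDegree_pow_le_of_le _ le_rfl)
          (natDegree_pow_le_of_le _ hb'm), coeff_pow_of_natDegree_le le_rfl,
        coeff_pow_of_natDegree_le hb'm, hb'c]
      change a.leadingCoeff ^ i * _ = _
      rw [← pow_add, hi']
    rw [finsetSum_coeff, Finset.sum_congr rfl this, Finset.sum_const, Finset.card_range,
      nsmul_eq_mul]
    exact mul_ne_zero (Nat.cast_ne_zero.2 hx.ne') (pow_ne_zero _ ha0)
  have hG0 : (∑ i ∈ Finset.range n, a ^ i * b' ^ (n - 1 - i)) ≠ 0 := fun h => hG (by simp [h])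
  have h2 := le_natDegree_of_ne_zero hG
  rw [← Commute.geom_sum₂_mul (Commute.all a b'), natDegree_mul hG0 he] at hdeg
  omega

end Polynomial

open Polynomial in
/-- A polynomial of degree at least two which becomes a multiple of `(X - z) ^ d` after
subtracting `z` is exceptional. -/
theorem isExceptional_of_coeff_eq_zero {P : ℂ[X]} (hP : 2 ≤ P.natDegree) (z : ℂ)
    (h : ∀ j < P.natDegree, (P.comp (X + C z) - C z).coeff j = 0) : IsExceptional P := by
  set d := P.natDegree with hd
  set R := P.comp (X + C z) - C z with hR
  have hPR : P.comp (X + C z) = R + C z := by rw [hR]; ring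
  have hRd : R.natDegree ≤ d := by
    refine (natDegree_sub_le _ _).trans (max_le ?_ ?_)
    · rw [natDegree_comp, natDegree_X_add_C, mul_one]
    · simp
  have hRX : R = C (R.coeff d) * X ^ d := by
    ext j
    rw [coeff_C_mul_X_pow]
    split_ifs with hj
    · rw [hj]
    · rcases lt_or_gt_of_ne hj with hj | hj
      · exact h j hj
      · exact coeff_eq_zero_of_natDegree_lt (hRd.trans_lt hj)
  have hr : R.coeff d ≠ 0 := by
    intro h0
    rw [h0, C_0, zero_mul] at hRX
    have := congrArg natDegree hPR
    rw [hRX, natDegree_comp, natDegree_X_add_C, zero_add, natDegree_C] at this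
    omega
  obtain ⟨k, hk⟩ := IsAlgClosed.exists_pow_nat_eq (R.coeff d) (show 0 < d - 1 by omega)
  have hk0 : k ≠ 0 := by
    rintro rfl
    rw [zero_pow (by omega)] at hk
    exact hr hk.symm
  refine Or.inr ⟨k, -(k * z), hk0, Or.inl ?_⟩
  have hPz : P = (R + C z).comp (X - C z) := by
    rw [← hPR, comp_assoc]
    simp
  have h1 : (X - C z).comp (C k⁻¹ * (X - C (-(k * z)))) = C k⁻¹ * X := by
    have : C k⁻¹ * C k = (1 : ℂ[X]) := by rw [← C_mul, inv_mul_cancel₀ hk0, C_1]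
    simp only [sub_comp, X_comp, C_comp, C_neg, C_mul]
    linear_combination C z * this
  have h2 : k * (k ^ (d - 1) * (k⁻¹) ^ d) = 1 := by
    rw [← mul_assoc, ← pow_succ', Nat.sub_add_cancel (by omega), inv_pow,
      mul_inv_cancel₀ (pow_ne_zero _ hk0)]
  rw [affConj, comp_assoc]
  nth_rewrite 1 [hPz]
  rw [comp_assoc, h1, hRX, ← hk]
  simp only [add_comp, mul_comp, C_comp, pow_comp, X_comp, mul_pow, C_neg, neg_comp, C_mul]
  have h3 := congrArg (C : ℂ → ℂ[X]) h2
  simp only [C_mul, C_pow, C_1] at h3 ⊢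
  linear_combination X ^ d * h3

/-- Any two principal left ideals of a right amenable semigroup of polynomials intersect. -/
theorem PolyRightInv.exists_comp_eq_comp {S : Set (Polynomial ℂ)} {M : Mean S}
    (hM : PolyRightInv S M) (hcomp : ∀ p ∈ S, ∀ q ∈ S, p.comp q ∈ S) {a b : Polynomial ℂ}
    (ha : a ∈ S) (hb : b ∈ S) : ∃ x ∈ S, ∃ y ∈ S, x.comp a = y.comp b := by
  classical
  by_contra! hne
  let ind (p : Polynomial ℂ) (s : S) : ℝ := if ∃ x ∈ S, x.comp p = s then 1 else 0
  have hind (p : Polynomial ℂ) : Bdd (ind p) := ⟨1, fun s => by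
    simp only [ind]; split_ifs <;> simp⟩
  have hone (p : Polynomial ℂ) (hp : p ∈ S) : M.toFun (ind p) = 1 := by
    rw [← hM ⟨p, hp⟩ (fun g => hcomp _ g.2 _ hp) _ (hind p), ← M.one']
    congr 1
    funext g
    exact if_pos ⟨g, g.2, rfl⟩
  have hbdd : Bdd (ind a + ind b) := ⟨2, fun s => by
    simp only [ind, Pi.add_apply]; split_ifs <;> norm_num⟩
  have hconst : Bdd (fun _ : S => (1 : ℝ)) := ⟨1, by simp⟩
  have hneg : Bdd ((-1 : ℝ) • (ind a + ind b)) := ⟨2, fun s => by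
    simp only [ind, Pi.add_apply, Pi.smul_apply]; split_ifs <;> norm_num⟩
  have hsum : Bdd ((fun _ : S => (1 : ℝ)) + (-1 : ℝ) • (ind a + ind b)) := ⟨3, fun s => by
    simp only [ind, Pi.add_apply, Pi.smul_apply]; split_ifs <;> norm_num⟩
  have hnn := M.nonneg' _ hsum fun s => by
    simp only [ind, Pi.add_apply, Pi.smul_apply]
    split_ifs with h1 h2
    · obtain ⟨x, hx, hxs⟩ := h1
      obtain ⟨y, hy, hys⟩ := h2
      exact absurd (hxs.trans hys.symm) (hne x hx y hy)
    all_goals norm_num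
  rw [M.map_add' _ _ hconst hneg, M.map_smul' _ _ hbdd, M.map_add' _ _ (hind a) (hind b),
    hone a ha, hone b hb, M.one'] at hnn
  norm_num at hnn

open Polynomial in
/-- In a non-exceptional semigroup of polynomials whose principal left ideals pairwise intersect,
the number of elements of a given degree is bounded. -/
theorem exists_encard_natDegree_eq_le {S : Set ℂ[X]} (hdeg : ∀ p ∈ S, 0 < p.natDegree)
    (hcomp : ∀ p ∈ S, ∀ q ∈ S, p.comp q ∈ S) (hexc : ∃ P ∈ S, ¬ IsExceptional P)
    (hrev : ∀ a ∈ S, ∀ b ∈ S, ∃ x ∈ S, ∃ y ∈ S, x.comp a = y.comp b) :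
    ∃ K : ℕ, ∀ D : ℕ, {s : S | (s : ℂ[X]).natDegree = D}.encard ≤ K := by
  obtain ⟨P, hPS, hP⟩ := hexc
  have hP2 : 2 ≤ P.natDegree := by
    by_contra h
    exact hP (Or.inl (by omega))
  obtain ⟨z, hz⟩ := exists_fixedPoint_of_comp_linear hP2
  have haff : ∀ a ∈ S, ∀ b ∈ S, a.natDegree = b.natDegree →
      ∃ l c : ℂ, l ≠ 0 ∧ a = C l * b + C c := by
    intro a ha b hb hab
    obtain ⟨x, hx, y, -, hxy⟩ := hrev a ha b hb
    exact exists_affine_of_comp_eq_comp (hdeg a ha) hab (hdeg x hx) hxy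
  have hPdeg : ∀ a b : ℂ[X], a.natDegree = b.natDegree →
      (P.comp a).natDegree = (P.comp b).natDegree := fun a b h => by
    rw [natDegree_comp, natDegree_comp, h]
  have hmul : ∀ a ∈ S, ∀ b ∈ S, a.natDegree = b.natDegree →
      ∃ l : ℂ, l ≠ 0 ∧ a - C z = C l * (b - C z) := by
    intro a ha b hb hab
    obtain ⟨l, c, hl, h⟩ := haff a ha b hb hab
    obtain ⟨m, d, -, h'⟩ := haff _ (hcomp P hPS a ha) _ (hcomp P hPS b hb) (hPdeg a b hab)
    have hfix : l * z + c = z := by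
      refine hz l c m d hl (comp_left_injective (hdeg b hb) ?_)
      simp only [comp_assoc, add_comp, mul_comp, C_comp, X_comp]
      rw [← h, h']
    refine ⟨l, hl, ?_⟩
    have hfix' := congrArg (C : ℂ → ℂ[X]) hfix
    rw [C_add, C_mul] at hfix'
    rw [h]
    linear_combination hfix'
  set R := P.comp (X + C z) - C z with hR
  obtain ⟨j, hj, hRj⟩ : ∃ j < P.natDegree, R.coeff j ≠ 0 := by
    by_contra! h
    exact hP (isExceptional_of_coeff_eq_zero hP2 z h)
  have hRd : R.coeff P.natDegree ≠ 0 := by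
    have : R.natDegree = P.natDegree := by
      rw [hR, natDegree_sub_C, natDegree_comp, natDegree_X_add_C, mul_one]
    rw [← this]
    refine leadingCoeff_ne_zero.2 fun h => ?_
    rw [h, natDegree_zero] at this
    omega
  have hRcomp (a : ℂ[X]) : R.comp (a - C z) = P.comp a - C z := by
    simp [hR, comp_assoc]
  have hroot : ∀ a ∈ S, ∀ b ∈ S, a.natDegree = b.natDegree →
      ∃ l : ℂ, l ^ (P.natDegree - j) = 1 ∧ a = C z + C l * (b - C z) := by
    intro a ha b hb hab
    obtain ⟨l, hl, h⟩ := hmul a ha b hb hab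
    obtain ⟨m, -, h'⟩ := hmul _ (hcomp P hPS a ha) _ (hcomp P hPS b hb) (hPdeg a b hab)
    refine ⟨l, ?_, by rw [← h]; ring⟩
    have hbz : 0 < (b - C z).natDegree := by rw [natDegree_sub_C]; exact hdeg b hb
    have hRl : R.comp (C l * X) = C m * R := by
      apply comp_left_injective hbz
      simp only [comp_assoc, mul_comp, C_comp, X_comp]
      rw [← h, hRcomp, hRcomp, h']
    have hco (i : ℕ) (hi : R.coeff i ≠ 0) : l ^ i = m := by
      have := congrArg (fun q => coeff q i) hRl
      simp only [comp_C_mul_X_coeff, coeff_C_mul] at this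
      exact mul_left_cancel₀ hi (this.trans (mul_comm _ _))
    have hlj : l ^ (P.natDegree - j) * l ^ j = 1 * l ^ j := by
      rw [← pow_add, Nat.sub_add_cancel hj.le, hco _ hRd, hco _ hRj, one_mul]
    exact mul_right_cancel₀ (pow_ne_zero _ hl) hlj
  refine ⟨(nthRootsFinset (P.natDegree - j) (1 : ℂ)).card, fun D => ?_⟩
  rcases Set.eq_empty_or_nonempty {s : S | (s : ℂ[X]).natDegree = D} with h | ⟨b, hb⟩
  · simp [h]
  rw [← Subtype.val_injective.encard_image]
  refine (Set.encard_le_encard (t := (fun l => C z + C l * ((b : ℂ[X]) - C z)) ''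
    (nthRootsFinset (P.natDegree - j) (1 : ℂ) : Set ℂ)) ?_).trans
    ((Set.encard_image_le _ _).trans (Set.encard_coe_eq_coe_finsetCard _).le)
  rintro _ ⟨a, ha, rfl⟩
  obtain ⟨l, hl, h⟩ := hroot a a.2 b b.2 (Eq.trans ha (Eq.symm hb))
  exact ⟨l, by simpa [mem_nthRootsFinset (show 0 < P.natDegree - j by omega)] using hl, h.symm⟩

/-- Averages of a bounded function over finite sets of constant cardinality are bounded. -/
theorem Bdd.average {σ τ : Type*} {f : σ → ℝ} (hf : Bdd f) {k : ℕ} (F : τ → Finset σ)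
    (hF : ∀ t, (F t).card = k) : Bdd fun t => (k : ℝ)⁻¹ * ∑ s ∈ F t, f s := by
  obtain ⟨C, hC⟩ := hf
  refine ⟨(k : ℝ)⁻¹ * (k * C), fun t => ?_⟩
  rw [abs_mul, abs_of_nonneg (by positivity : (0 : ℝ) ≤ (k : ℝ)⁻¹)]
  refine mul_le_mul_of_nonneg_left ?_ (by positivity)
  refine (Finset.abs_sum_le_sum_abs _ _).trans ((Finset.sum_le_sum fun s _ => hC s).trans ?_)
  rw [Finset.sum_const, hF, nsmul_eq_mul]

/-- The mean obtained by integrating, against `M`, averages over finite sets of constant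
cardinality. -/
noncomputable def Mean.average {σ τ : Type*} (M : Mean τ) (k : ℕ) (hk : k ≠ 0)
    (F : τ → Finset σ) (hF : ∀ t, (F t).card = k) : Mean σ where
  toFun f := M.toFun fun t => (k : ℝ)⁻¹ * ∑ s ∈ F t, f s
  map_add' f g hf hg := by
    rw [← M.map_add' _ _ (hf.average F hF) (hg.average F hF)]
    congr 1
    funext t
    simp [Finset.sum_add_distrib, mul_add]
  map_smul' c f hf := by
    rw [← M.map_smul' _ _ (hf.average F hF)]
    congr 1
    funext t
    simp only [Pi.smul_apply, smul_eq_mul, ← Finset.mul_sum]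
    ring
  nonneg' f hf h := M.nonneg' _ (hf.average F hF) fun t =>
    mul_nonneg (by positivity) (Finset.sum_nonneg fun s _ => h s)
  one' := by
    refine (congrArg M.toFun (funext fun t => ?_)).trans M.one'
    simp [hF, hk]

/-- A non-exceptional right amenable semigroup of (nonconstant complex) polynomials
that is left cancellative is amenable. -/
theorem right_amenable_left_cancellative_amenable
    (S : Set (Polynomial ℂ)) (hne : S.Nonempty)
    (hdeg : ∀ p ∈ S, 0 < p.natDegree)
    (hcomp : ∀ p ∈ S, ∀ q ∈ S, p.comp q ∈ S)
    (hexc : ∃ P ∈ S, ¬ IsExceptional P)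
    (hRA : ∃ M : Mean S, PolyRightInv S M)
    (hlc : PolyLeftCancellative S) :
    ∃ M : Mean S, PolyLeftInv S M ∧ PolyRightInv S M := by
  classical
  obtain ⟨M, hM⟩ := hRA
  obtain ⟨K, hK⟩ := exists_encard_natDegree_eq_le hdeg hcomp hexc
    fun a ha b hb => hM.exists_comp_eq_comp hcomp ha hb
  have hfin (D : ℕ) : {s : S | (s : Polynomial ℂ).natDegree = D}.Finite :=
    Set.finite_of_encard_le_coe (hK D)
  let L (D : ℕ) : Finset S := (hfin D).toFinset
  have hmem (D : ℕ) (s : S) : s ∈ L D ↔ (s : Polynomial ℂ).natDegree = D := by simp [L]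
  have hcard (D : ℕ) : (L D).card ≤ K := by
    have h := hK D
    rw [(hfin D).encard_eq_coe_toFinset_card] at h
    exact_mod_cast h
  let mul (a b : S) : S := ⟨(a : Polynomial ℂ).comp b, hcomp _ a.2 _ b.2⟩
  have hmuldeg (a b : S) : (mul a b : Polynomial ℂ).natDegree =
      (a : Polynomial ℂ).natDegree * (b : Polynomial ℂ).natDegree := Polynomial.natDegree_comp
  have hlinj (a : S) : Function.Injective (mul a) := fun b c h =>
    Subtype.ext (hlc a a.2 b b.2 c c.2 (congrArg Subtype.val h))
  have hrinj (a : S) : Function.Injective (fun b => mul b a) := fun b c h =>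
    Subtype.ext (Polynomial.comp_left_injective (hdeg a a.2) (congrArg Subtype.val h))
  -- a degree with the maximal number of elements
  have : Nonempty S := hne.to_subtype
  obtain ⟨n, hn⟩ : ∃ n : S, ∀ t : S, (L (t : Polynomial ℂ).natDegree).card ≤
      (L (n : Polynomial ℂ).natDegree).card := by
    have hbdd : BddAbove (Set.range fun t : S => (L (t : Polynomial ℂ).natDegree).card) :=
      ⟨K, by rintro _ ⟨t, rfl⟩; exact hcard _⟩
    obtain ⟨n, hn⟩ := Nat.sSup_mem (Set.range_nonempty _) hbdd
    exact ⟨n, fun t => (le_csSup hbdd ⟨t, rfl⟩).trans hn.ge⟩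
  let F (g : S) : Finset S := L (mul n g : Polynomial ℂ).natDegree
  have hF (g : S) : (F g).card = (L (n : Polynomial ℂ).natDegree).card := by
    refine le_antisymm (hn _) (Finset.card_le_card_of_injOn (fun b => mul b g) ?_
      (hrinj g).injOn)
    intro b hb
    have hb' := (hmem _ _).1 hb
    exact (hmem _ _).2 (by rw [hmuldeg, hmuldeg, hb'])
  have hleft (h g : S) : (F g).image (mul h) = F (mul g h) := by
    refine Finset.eq_of_subset_of_card_le ?_ ?_
    · intro s hs
      obtain ⟨t, ht, rfl⟩ := Finset.mem_image.1 hs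
      have ht' := (hmem _ _).1 ht
      refine (hmem _ _).2 ?_
      rw [hmuldeg, ht', hmuldeg, hmuldeg, hmuldeg]
      ring
    · rw [Finset.card_image_of_injective _ (hlinj h), hF, hF]
  have hright (h g : S) : (F g).image (fun s => mul s h) = F (mul g h) := by
    refine Finset.eq_of_subset_of_card_le ?_ ?_
    · intro s hs
      obtain ⟨t, ht, rfl⟩ := Finset.mem_image.1 hs
      have ht' := (hmem _ _).1 ht
      refine (hmem _ _).2 ?_
      rw [hmuldeg, ht', hmuldeg, hmuldeg, hmuldeg]
      ring
    · rw [Finset.card_image_of_injective _ (hrinj h), hF, hF]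
  have hk : (L (n : Polynomial ℂ).natDegree).card ≠ 0 :=
    Finset.card_ne_zero_of_mem ((hmem _ n).2 rfl)
  refine ⟨M.average _ hk F hF, fun h hc f hf => ?_, fun h hc f hf => ?_⟩
  · refine Eq.trans ?_ (hM h (fun g => hcomp _ g.2 _ h.2) _ (hf.average F hF))
    refine congrArg M.toFun (funext fun g => ?_)
    change _ = _ * ∑ s ∈ F (mul g h), f s
    rw [← hleft, Finset.sum_image (hlinj h).injOn]
  · refine Eq.trans ?_ (hM h (fun g => hcomp _ g.2 _ h.2) _ (hf.average F hF))
    refine congrArg M.toFun (funext fun g => ?_)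
    change _ = _ * ∑ s ∈ F (mul g h), f s
    rw [← hright, Finset.sum_image (hrinj h).injOn]
end

section
/- Every cancellative subsemigroup S of MP (the semigroup, under composition, of all monomial maps z ↦ λ z^n of ℂ with λ ∈ ℂ \ {0} and n ≥ 1) is embeddable into a group. -/
/-- The semigroup `MP` of all monomial maps `z ↦ λ zⁿ` of `ℂ`, `λ ≠ 0`, `n ≥ 1`. -/
def MPset : Set (ℂ → ℂ) :=
  {f | ∃ lam : ℂ, lam ≠ 0 ∧ ∃ n : ℕ, 1 ≤ n ∧ f = fun z => lam * z ^ n}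

/-- The complex units killed by raising to the degree of some monomial map in `S`. -/
def degreeTorsion (S : Set (ℂ → ℂ)) (hSMP : S ⊆ MPset) (hne : S.Nonempty)
    (hcomp : ∀ f ∈ S, ∀ g ∈ S, f ∘ g ∈ S) : Subgroup ℂˣ where
  carrier := {u | ∃ (lam : ℂ) (n : ℕ), (fun z => lam * z ^ n) ∈ S ∧ u ^ n = 1}
  one_mem' := by
    obtain ⟨f, hf⟩ := hne
    obtain ⟨lam, -, n, -, rfl⟩ := hSMP hf
    exact ⟨lam, n, hf, one_pow n⟩
  mul_mem' := by
    rintro u v ⟨lam, n, hf, hu⟩ ⟨mu, m, hg, hv⟩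
    refine ⟨lam * mu ^ n, m * n, ?_, ?_⟩
    · convert hcomp _ hf _ hg using 1
      funext z
      simp only [Function.comp_apply]
      ring
    · rw [mul_pow, mul_comm m n, pow_mul, hu, mul_comm n m, pow_mul, hv]
      simp
  inv_mem' := by
    rintro u ⟨lam, n, hf, hu⟩
    exact ⟨lam, n, hf, by simp [hu]⟩

lemma Complex.exists_units_pow_eq {n : ℕ} (hn : 1 ≤ n) (u : ℂˣ) : ∃ v : ℂˣ, v ^ n = u := by
  obtain ⟨w, hw⟩ := IsAlgClosed.exists_pow_nat_eq (u : ℂ) hn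
  have hw0 : w ≠ 0 := by
    rintro rfl
    exact u.ne_zero (by rw [← hw, zero_pow (by omega)])
  exact ⟨Units.mk0 w hw0, Units.ext (by simpa using hw)⟩

section degreeTorsion

variable {S : Set (ℂ → ℂ)} (hSMP : S ⊆ MPset) (hne : S.Nonempty)
  (hcomp : ∀ f ∈ S, ∀ g ∈ S, f ∘ g ∈ S)

lemma mem_degreeTorsion_of_pow_mem {lam : ℂ} {n : ℕ} (hf : (fun z => lam * z ^ n) ∈ S) {u : ℂˣ}
    (hu : u ^ n ∈ degreeTorsion S hSMP hne hcomp) : u ∈ degreeTorsion S hSMP hne hcomp := by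
  obtain ⟨mu, m, hg, hm⟩ := hu
  refine ⟨mu * lam ^ m, n * m, ?_, by rw [pow_mul, hm]⟩
  convert hcomp _ hg _ hf using 1
  funext z
  simp only [Function.comp_apply]
  ring

/-- A monomial map in `S` permutes the complex units modulo `degreeTorsion`. -/
lemma exists_perm_quotient_degreeTorsion (f : S) :
    ∃ e : Equiv.Perm (ℂˣ ⧸ degreeTorsion S hSMP hne hcomp),
      ∀ u v : ℂˣ, (v : ℂ) = (f : ℂ → ℂ) u → e u = v := by
  obtain ⟨f, hf⟩ := f
  obtain ⟨lam, hlam, n, hn, rfl⟩ := hSMP hf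
  let a : ℂˣ := Units.mk0 lam hlam
  let F : ℂˣ ⧸ degreeTorsion S hSMP hne hcomp → ℂˣ ⧸ degreeTorsion S hSMP hne hcomp :=
    fun x => (a : ℂˣ ⧸ degreeTorsion S hSMP hne hcomp) * x ^ n
  have hF : Function.Bijective F := by
    constructor
    · intro x y
      induction x using QuotientGroup.induction_on with | H u =>
      induction y using QuotientGroup.induction_on with | H v =>
      intro h
      replace h : ((a * u ^ n : ℂˣ) : ℂˣ ⧸ degreeTorsion S hSMP hne hcomp) =
        (a * v ^ n : ℂˣ) := h
      rw [QuotientGroup.eq, mul_inv_rev, mul_assoc, inv_mul_cancel_left] at h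
      rw [QuotientGroup.eq]
      refine mem_degreeTorsion_of_pow_mem hSMP hne hcomp hf ?_
      rwa [mul_pow, inv_pow]
    · intro y
      induction y using QuotientGroup.induction_on with | H v =>
      obtain ⟨w, hw⟩ := Complex.exists_units_pow_eq hn (a⁻¹ * v)
      refine ⟨w, ?_⟩
      change (a : ℂˣ ⧸ degreeTorsion S hSMP hne hcomp) *
        (w : ℂˣ ⧸ degreeTorsion S hSMP hne hcomp) ^ n = v
      rw [← QuotientGroup.mk_pow, ← QuotientGroup.mk_mul, hw, mul_inv_cancel_left]
  refine ⟨Equiv.ofBijective F hF, fun u v huv => ?_⟩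
  have : v = a * u ^ n := Units.ext (by simpa [a] using huv)
  rw [this]
  rfl

end degreeTorsion

/-- Every cancellative subsemigroup of the semigroup `MP` of monomial maps of `ℂ`
(under composition) is embeddable into a group. -/
theorem cancellative_subsemigroup_of_MP_embeddable
    (S : Set (ℂ → ℂ)) (hSMP : S ⊆ MPset) (hne : S.Nonempty)
    (hcomp : ∀ f ∈ S, ∀ g ∈ S, f ∘ g ∈ S)
    (hlc : ∀ a ∈ S, ∀ b ∈ S, ∀ c ∈ S, a ∘ b = a ∘ c → b = c)
    (hrc : ∀ a ∈ S, ∀ b ∈ S, ∀ c ∈ S, b ∘ a = c ∘ a → b = c) :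
    ∃ (G : Type) (_ : Group G) (φ : S → G), Function.Injective φ ∧
      ∀ x y : S, φ ⟨(x : ℂ → ℂ) ∘ (y : ℂ → ℂ), hcomp _ x.2 _ y.2⟩ = φ x * φ y := by
  have hval : ∀ (f : S) (u : ℂˣ), (f : ℂ → ℂ) u ≠ 0 := by
    rintro ⟨f, hf⟩ u
    obtain ⟨lam, hlam, n, -, rfl⟩ := hSMP hf
    exact mul_ne_zero hlam (pow_ne_zero _ u.ne_zero)
  choose φ hφ using exists_perm_quotient_degreeTorsion hSMP hne hcomp
  refine ⟨Equiv.Perm (ℂˣ ⧸ degreeTorsion S hSMP hne hcomp), inferInstance, φ, ?_, ?_⟩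
  · rintro ⟨f, hf⟩ ⟨g, hg⟩ h
    have key : ∀ u v w : ℂˣ, (v : ℂ) = f u → (w : ℂ) = g u →
        v⁻¹ * w ∈ degreeTorsion S hSMP hne hcomp := fun u v w hv hw => by
      rw [← QuotientGroup.eq, ← hφ ⟨f, hf⟩ u v hv, ← hφ ⟨g, hg⟩ u w hw, h]
    obtain ⟨lam, hlam, n, hn, rfl⟩ := hSMP hf
    obtain ⟨mu, hmu, m, hm, rfl⟩ := hSMP hg
    let a : ℂˣ := Units.mk0 lam hlam
    let b : ℂˣ := Units.mk0 mu hmu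
    let c : ℂˣ := Units.mk0 2 two_ne_zero
    have h1 := key 1 a b (by simp [a]) (by simp [b])
    have h2 := key c (a * c ^ n) (b * c ^ m) (by simp [a, c]) (by simp [b, c])
    have hnm : n = m := by
      have h3 := mul_mem (inv_mem h1) h2
      have h4 : (a⁻¹ * b)⁻¹ * ((a * c ^ n)⁻¹ * (b * c ^ m)) = (c ^ n)⁻¹ * c ^ m := by
        ext
        push_cast
        field_simp
      rw [h4] at h3
      obtain ⟨nu, k, hk, hpow⟩ := h3
      obtain ⟨nu', hnu', k', hk', heq⟩ := hSMP hk
      have hk0 : k ≠ 0 := by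
        rintro rfl
        have e0 := congrFun heq 0
        have e1 := congrFun heq 1
        simp [show k' ≠ 0 by omega] at e0 e1
        simp_all
      rw [mul_pow, inv_pow, inv_mul_eq_one] at hpow
      have hpow' := congrArg (fun u : ℂˣ => (u : ℂ)) hpow
      simp only [Units.val_pow_eq_pow_val, c, Units.val_mk0, ← pow_mul] at hpow'
      have : (2 : ℕ) ^ (n * k) = 2 ^ (m * k) := by exact_mod_cast hpow'
      exact Nat.eq_of_mul_eq_mul_right (by omega) (Nat.pow_right_injective le_rfl this)
    subst hnm
    obtain ⟨nu, k, hk, hpow⟩ := h1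
    rw [mul_pow, inv_pow, inv_mul_eq_one] at hpow
    have hpow' : lam ^ k = mu ^ k := by
      simpa [a, b] using congrArg (fun u : ℂˣ => (u : ℂ)) hpow
    refine Subtype.ext (hlc _ hk _ hf _ hg ?_)
    funext z
    simp only [Function.comp_apply, mul_pow, hpow']
  · intro x y
    ext q
    induction q using QuotientGroup.induction_on with | H u =>
    let v : ℂˣ := Units.mk0 _ (hval y u)
    let w : ℂˣ := Units.mk0 _ (hval x v)
    rw [Equiv.Perm.mul_apply, hφ y u v rfl, hφ x v w rfl]
    exact hφ _ u w rfl
end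

section
/- Let P and Q be polynomials with complex coefficients of degree at least 2 (so that they share the common superattracting fixed point at infinity). If the semigroup S generated by P and Q under composition is cancellative, then S is embeddable into a group. -/
/-- The subsemigroup (under polynomial composition) generated by a set `G` of
polynomials: the smallest set containing `G` and closed under composition. -/
inductive PolyGen (G : Set (Polynomial ℂ)) : Polynomial ℂ → Prop
  | base {p : Polynomial ℂ} (hp : p ∈ G) : PolyGen G p
  | comp {p q : Polynomial ℂ} (hp : PolyGen G p) (hq : PolyGen G q) : PolyGen G (p.comp q)

open Polynomial in
/-- The logarithmic derivatives of `f` and `g` agree at infinity up to an error `O(z ^ (-1 - N))`. -/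
def LogClose (N : ℕ) (f g : ℂ[X]) : Prop :=
  wronskian f g = 0 ∨ (wronskian f g).natDegree + N < f.natDegree + g.natDegree

namespace LogClose

open Polynomial

theorem refl (N : ℕ) (f : ℂ[X]) : LogClose N f f := Or.inl (wronskian_self_eq_zero f)

theorem symm {N : ℕ} {f g : ℂ[X]} (h : LogClose N f g) : LogClose N g f := by
  unfold LogClose at *
  rwa [← wronskian_neg_eq, natDegree_neg, neg_eq_zero, add_comm g.natDegree]

theorem mono {M N : ℕ} {f g : ℂ[X]} (h : LogClose N f g) (hMN : M ≤ N) : LogClose M f g :=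
  h.imp id (by omega)

theorem trans {N : ℕ} {f g h : ℂ[X]} (hg : g ≠ 0) (hfg : LogClose N f g) (hgh : LogClose N g h) :
    LogClose N f h := by
  have key : wronskian f h * g = wronskian f g * h + wronskian g h * f := by
    unfold wronskian; ring
  by_cases h0 : wronskian f h = 0
  · exact Or.inl h0
  right
  have hdeg : (wronskian f h * g).natDegree = (wronskian f h).natDegree + g.natDegree :=
    natDegree_mul h0 hg
  have hle := natDegree_add_le (wronskian f g * h) (wronskian g h * f)
  rw [← key, hdeg] at hle
  have h1 := natDegree_mul_le (p := wronskian f g) (q := h)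
  have h2 := natDegree_mul_le (p := wronskian g h) (q := f)
  rcases hfg with hfg | hfg <;> rcases hgh with hgh | hgh
  · rw [hfg, hgh] at key
    simp [h0, hg] at key
  · rw [hfg, zero_mul, zero_add] at key
    rw [key] at hdeg
    omega
  · rw [hgh, zero_mul, add_zero] at key
    rw [key] at hdeg
    omega
  · omega

theorem comp_right {N : ℕ} {f g : ℂ[X]} (h : LogClose N f g) {q : ℂ[X]} (hq : 1 ≤ q.natDegree) :
    LogClose (N * q.natDegree) (f.comp q) (g.comp q) := by
  have key : wronskian (f.comp q) (g.comp q) = (wronskian f g).comp q * derivative q := by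
    simp only [wronskian, derivative_comp, sub_comp, mul_comp]; ring
  rcases h with h | h
  · left; rw [key, h]; simp
  right
  have h1 := natDegree_mul_le (p := (wronskian f g).comp q) (q := derivative q)
  have h2 := natDegree_derivative_le q
  rw [← key, natDegree_comp] at h1
  rw [natDegree_comp, natDegree_comp]
  have h3 : ((wronskian f g).natDegree + N + 1) * q.natDegree
      ≤ (f.natDegree + g.natDegree) * q.natDegree := Nat.mul_le_mul_right _ h
  simp only [add_mul, one_mul] at h3
  omega

theorem one_of_natDegree_eq {f g : ℂ[X]} (h : f.natDegree = g.natDegree) : LogClose 1 f g := by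
  by_cases hW : wronskian f g = 0
  · exact Or.inl hW
  right
  have hg : g ≠ 0 := by rintro rfl; simp at hW
  have hf : f ≠ 0 := by rintro rfl; simp at hW
  set r := C g.leadingCoeff * f - C f.leadingCoeff * g with hr
  have key : wronskian r g = C g.leadingCoeff * wronskian f g := by
    simp only [hr, wronskian, derivative_sub, derivative_C_mul]; ring
  have hc : g.leadingCoeff ≠ 0 := leadingCoeff_ne_zero.2 hg
  have hc' : f.leadingCoeff ≠ 0 := leadingCoeff_ne_zero.2 hf
  have hrg : wronskian r g ≠ 0 := by rw [key]; exact mul_ne_zero (C_ne_zero.2 hc) hW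
  have h1 := natDegree_wronskian_lt_add hrg
  rw [key, natDegree_C_mul hc] at h1
  have h2 : r.natDegree < f.natDegree := by
    have hr0 : r ≠ 0 := by intro h0; rw [h0] at hrg; simp at hrg
    apply natDegree_lt_natDegree hr0
    have : (C g.leadingCoeff * f).degree = f.degree := degree_C_mul hc
    rw [← this]
    apply degree_sub_lt_left
    · rw [degree_C_mul hc, degree_C_mul hc', degree_eq_natDegree hf, degree_eq_natDegree hg, h]
    · exact mul_ne_zero (C_ne_zero.2 hc) hf
    · simp [mul_comm]
  omega

theorem natDegree_X_mul_derivative_sub_lt {h : ℂ[X]} (hh : 1 ≤ h.natDegree) :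
    (X * derivative h - C (h.natDegree : ℂ) * h).natDegree < h.natDegree := by
  suffices (X * derivative h - C (h.natDegree : ℂ) * h).natDegree ≤ h.natDegree - 1 by omega
  rw [natDegree_le_iff_coeff_eq_zero]
  intro k hk
  obtain ⟨k, rfl⟩ : ∃ l, k = l + 1 := ⟨k - 1, by omega⟩
  rw [coeff_sub, coeff_X_mul, coeff_derivative, coeff_C_mul]
  rcases eq_or_lt_of_le (show h.natDegree ≤ k + 1 by omega) with e | e
  · rw [e]; push_cast; ring
  · rw [coeff_eq_zero_of_natDegree_lt e]; simp

theorem comp_left_iff {N : ℕ} {f g h : ℂ[X]} (hh : 1 ≤ h.natDegree) (hf : 1 ≤ f.natDegree)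
    (hfg : f.natDegree = g.natDegree) (hN : N ≤ f.natDegree) :
    LogClose N (h.comp f) (h.comp g) ↔ LogClose N f g := by
  set r := X * derivative h - C (h.natDegree : ℂ) * h with hr
  have hr_lt : r.natDegree < h.natDegree := natDegree_X_mul_derivative_sub_lt hh
  have hrc (p : ℂ[X]) :
      p * (derivative h).comp p = C (h.natDegree : ℂ) * h.comp p + r.comp p := by
    simp [hr, sub_comp, mul_comp]
  set R := h.comp f * f * derivative g * r.comp g - r.comp f * derivative f * g * h.comp g with hR
  have key : (f * g) * wronskian (h.comp f) (h.comp g) =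
      (C (h.natDegree : ℂ) * (h.comp f * h.comp g)) * wronskian f g + R := by
    have e1 := hrc f
    have e2 := hrc g
    simp only [wronskian, derivative_comp, hR]
    linear_combination (h.comp f * f * derivative g) * e2 - (derivative f * g * h.comp g) * e1
  set d := f.natDegree with hd
  set n := h.natDegree with hn
  have hf0 : f ≠ 0 := by rintro rfl; simp [hd] at hf
  have hg0 : g ≠ 0 := by rintro rfl; simp at hfg; omega
  have hcomp0 {p : ℂ[X]} (hp : p.natDegree = d) : h.comp p ≠ 0 := by
    intro h0
    have := natDegree_comp (p := h) (q := p)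
    rw [h0, hp, natDegree_zero, ← hn] at this
    have := Nat.mul_le_mul hh hf
    omega
  have hRdeg : R.natDegree + N < 2 * (n * d) + 2 * d := by
    have a1 : (r.comp f).natDegree + d ≤ n * d := by
      rw [natDegree_comp]
      calc _ = (r.natDegree + 1) * d := by ring
        _ ≤ _ := Nat.mul_le_mul_right _ hr_lt
    have a2 : (r.comp g).natDegree + d ≤ n * d := by
      rw [natDegree_comp, ← hfg]
      calc _ = (r.natDegree + 1) * d := by ring
        _ ≤ _ := Nat.mul_le_mul_right _ hr_lt
    have b1 : (h.comp f).natDegree = n * d := natDegree_comp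
    have b2 : (h.comp g).natDegree = n * d := by rw [natDegree_comp, ← hfg]
    have c1 := natDegree_derivative_le f
    have c2 := natDegree_derivative_le g
    have t1 := natDegree_mul_le (p := h.comp f * f * derivative g) (q := r.comp g)
    have t2 := natDegree_mul_le (p := h.comp f * f) (q := derivative g)
    have t3 := natDegree_mul_le (p := h.comp f) (q := f)
    have u1 := natDegree_mul_le (p := r.comp f * derivative f * g) (q := h.comp g)
    have u2 := natDegree_mul_le (p := r.comp f * derivative f) (q := g)
    have u3 := natDegree_mul_le (p := r.comp f) (q := derivative f)
    have := natDegree_sub_le (h.comp f * f * derivative g * r.comp g)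
      (r.comp f * derivative f * g * h.comp g)
    rw [← hR] at this
    omega
  have hA0 : f * g ≠ 0 := mul_ne_zero hf0 hg0
  have hA : (f * g).natDegree = 2 * d := by rw [natDegree_mul hf0 hg0]; omega
  have hB0 : C (n : ℂ) * (h.comp f * h.comp g) ≠ 0 :=
    mul_ne_zero (C_ne_zero.2 (by exact_mod_cast (by omega : n ≠ 0)))
      (mul_ne_zero (hcomp0 rfl) (hcomp0 hfg.symm))
  have hB : (C (n : ℂ) * (h.comp f * h.comp g)).natDegree = 2 * (n * d) := by
    rw [natDegree_C_mul (by exact_mod_cast (by omega : n ≠ 0)),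
      natDegree_mul (hcomp0 rfl) (hcomp0 hfg.symm), natDegree_comp, natDegree_comp, ← hfg]
    ring
  unfold LogClose
  rw [natDegree_comp, natDegree_comp, ← hfg, ← hd, ← hn]
  generalize wronskian (h.comp f) (h.comp g) = V at *
  generalize wronskian f g = W at *
  generalize C (n : ℂ) * (h.comp f * h.comp g) = B at *
  generalize f * g = A at *
  constructor
  · intro hV
    by_cases hW : W = 0
    · exact Or.inl hW
    right
    have e : B * W = A * V - R := by rw [key]; ring
    have hle := natDegree_sub_le (A * V) R
    rw [← e, natDegree_mul hB0 hW, hB] at hle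
    have hAV := natDegree_mul_le (p := A) (q := V)
    rcases hV with rfl | hV
    · rw [mul_zero, natDegree_zero] at hle
      omega
    · omega
  · intro hW
    by_cases hV : V = 0
    · exact Or.inl hV
    right
    have hle := natDegree_add_le (B * W) R
    rw [← key, natDegree_mul hA0 hV, hA] at hle
    have hBW := natDegree_mul_le (p := B) (q := W)
    rcases hW with rfl | hW
    · rw [mul_zero, natDegree_zero] at hle
      omega
    · omega

theorem le_of_leadingCoeff_eq {N : ℕ} {f g : ℂ[X]} (h : LogClose N f g)
    (hfg : f.natDegree = g.natDegree) (hlc : f.leadingCoeff = g.leadingCoeff) (hne : f ≠ g) :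
    N + (f - g).natDegree ≤ f.natDegree := by
  set r := f - g with hr
  have hr0 : r ≠ 0 := sub_ne_zero.2 hne
  have hf0 : f ≠ 0 := by
    rintro rfl
    rw [leadingCoeff_zero, eq_comm, leadingCoeff_eq_zero] at hlc
    exact hne hlc.symm
  have hg0 : g ≠ 0 := by
    rintro rfl
    rw [leadingCoeff_zero, leadingCoeff_eq_zero] at hlc
    exact hne hlc
  have hrlt : r.natDegree < f.natDegree := by
    apply natDegree_lt_natDegree hr0
    apply degree_sub_lt_left _ hf0 hlc
    rw [degree_eq_natDegree hf0, degree_eq_natDegree hg0, hfg]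
  have hXd (p : ℂ[X]) : (X * derivative p).coeff p.natDegree = p.natDegree * p.leadingCoeff := by
    rcases Nat.eq_zero_or_pos p.natDegree with h0 | h0
    · rw [h0]; simp
    · obtain ⟨k, hk⟩ : ∃ k, p.natDegree = k + 1 := ⟨p.natDegree - 1, by omega⟩
      rw [leadingCoeff, hk, coeff_X_mul, coeff_derivative]; push_cast; ring
  have hXle (p : ℂ[X]) : (X * derivative p).natDegree ≤ p.natDegree := by
    rw [natDegree_le_iff_coeff_eq_zero]
    intro k hk
    obtain ⟨k, rfl⟩ : ∃ l, k = l + 1 := ⟨k - 1, by omega⟩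
    rw [coeff_X_mul, coeff_derivative, coeff_eq_zero_of_natDegree_lt hk, zero_mul]
  have key : X * wronskian f g = X * derivative f * r - f * (X * derivative r) := by
    simp only [hr, wronskian, derivative_sub]; ring
  have hcoeff : (X * wronskian f g).coeff (f.natDegree + r.natDegree) ≠ 0 := by
    rw [key, coeff_sub, coeff_mul_add_eq_of_natDegree_le (hXle f) le_rfl,
      coeff_mul_add_eq_of_natDegree_le le_rfl (hXle r), hXd, hXd]
    have : (f.natDegree : ℂ) - r.natDegree ≠ 0 := by
      rw [sub_ne_zero]; exact_mod_cast hrlt.ne'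
    have e : (f.natDegree : ℂ) * f.leadingCoeff * r.coeff r.natDegree -
        f.coeff f.natDegree * (r.natDegree * r.leadingCoeff) =
        (f.natDegree - r.natDegree) * (f.leadingCoeff * r.leadingCoeff) := by
      simp only [leadingCoeff]; ring
    rw [e]
    exact mul_ne_zero this
      (mul_ne_zero (leadingCoeff_ne_zero.2 hf0) (leadingCoeff_ne_zero.2 hr0))
  have hle := le_natDegree_of_ne_zero hcoeff
  have hle' := natDegree_mul_le (p := (X : ℂ[X])) (q := wronskian f g)
  rw [natDegree_X] at hle'
  rcases h with h | h
  · rw [h] at hcoeff; simp at hcoeff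
  · omega

end LogClose

/-- The composition of the polynomials `g b`, with `b` running through a word, read left to right. -/
noncomputable def wordPoly {α : Type*} (g : α → Polynomial ℂ) : List α → Polynomial ℂ
  | [] => Polynomial.X
  | b :: l => (g b).comp (wordPoly g l)

/-- Iterating `p` on the left eventually makes `f` and `h` logarithmically close to order `N`; in a
Böttcher coordinate of `p`, the images of `f` and `h` agree to order `N` up to a constant factor. -/
def BottcherClose (p : Polynomial ℂ) (N : ℕ) (f h : Polynomial ℂ) : Prop :=
  ∃ J, ∀ j ≥ J, LogClose N (p.comp^[j] f) (p.comp^[j] h)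

section Words

open Polynomial

variable {α : Type*} {g : α → ℂ[X]}

theorem wordPoly_append (u v : List α) :
    wordPoly g (u ++ v) = (wordPoly g u).comp (wordPoly g v) := by
  induction u with
  | nil => simp [wordPoly]
  | cons a u ih => simp [wordPoly, ih, comp_assoc]

theorem wordPoly_singleton (a : α) : wordPoly g [a] = g a := by simp [wordPoly]

theorem wordPoly_replicate_append (a : α) (j : ℕ) (u : List α) :
    wordPoly g (List.replicate j a ++ u) = (g a).comp^[j] (wordPoly g u) := by
  induction j with
  | zero => simp
  | succ j ih => rw [Function.iterate_succ_apply', ← ih]; rfl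

theorem two_pow_length_le_natDegree_wordPoly (hg : ∀ a, 2 ≤ (g a).natDegree) (u : List α) :
    2 ^ u.length ≤ (wordPoly g u).natDegree := by
  induction u with
  | nil => simp [wordPoly]
  | cons a u ih =>
    rw [wordPoly, natDegree_comp, List.length_cons, pow_succ, mul_comm]
    exact Nat.mul_le_mul (hg a) ih

theorem natDegree_wordPoly_pos (hg : ∀ a, 2 ≤ (g a).natDegree) (u : List α) :
    1 ≤ (wordPoly g u).natDegree :=
  Nat.one_le_two_pow.trans (two_pow_length_le_natDegree_wordPoly hg u)

theorem two_le_natDegree_wordPoly (hg : ∀ a, 2 ≤ (g a).natDegree) {u : List α} (hu : u ≠ []) :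
    2 ≤ (wordPoly g u).natDegree := by
  cases u with
  | nil => exact absurd rfl hu
  | cons a u =>
    rw [wordPoly, natDegree_comp]
    simpa using Nat.mul_le_mul (hg a) (natDegree_wordPoly_pos hg u)

theorem comp_right_cancel {p q r : ℂ[X]} (hr : 1 ≤ r.natDegree) (h : p.comp r = q.comp r) :
    p = q := by
  have h0 : (p - q).comp r = 0 := by rw [sub_comp, h, sub_self]
  rcases comp_eq_zero_iff.1 h0 with h1 | ⟨-, h1⟩
  · exact sub_eq_zero.1 h1
  · rw [h1, natDegree_C] at hr
    omega

theorem iterate_comp_comp (p f q : ℂ[X]) (j : ℕ) :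
    (p.comp^[j] f).comp q = p.comp^[j] (f.comp q) := by
  induction j with
  | zero => rfl
  | succ j ih => rw [Function.iterate_succ_apply', Function.iterate_succ_apply', comp_assoc, ih]

namespace BottcherClose

variable {p : ℂ[X]} {N : ℕ} {f h k : ℂ[X]}

theorem symm (H : BottcherClose p N f h) : BottcherClose p N h f :=
  H.imp fun _ hJ j hj => (hJ j hj).symm

theorem trans (hp : 1 ≤ p.natDegree) (hh : 1 ≤ h.natDegree) (H₁ : BottcherClose p N f h)
    (H₂ : BottcherClose p N h k) : BottcherClose p N f k := by
  obtain ⟨J₁, h₁⟩ := H₁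
  obtain ⟨J₂, h₂⟩ := H₂
  refine ⟨max J₁ J₂, fun j hj => (h₁ j (le_of_max_le_left hj)).trans ?_
    (h₂ j (le_of_max_le_right hj))⟩
  apply ne_zero_of_natDegree_gt (n := 0)
  rw [natDegree_iterate_comp]
  positivity

theorem comp_right (H : BottcherClose p N f h) (hN : 1 ≤ N) {q : ℂ[X]} (hq : 2 ≤ q.natDegree) :
    BottcherClose p (N + 1) (f.comp q) (h.comp q) := by
  obtain ⟨J, hJ⟩ := H
  refine ⟨J, fun j hj => ?_⟩
  rw [← iterate_comp_comp, ← iterate_comp_comp]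
  refine ((hJ j hj).comp_right (by omega)).mono ?_
  nlinarith

theorem iterate_left (H : BottcherClose p N f h) (i : ℕ) :
    BottcherClose p N (p.comp^[i] f) (p.comp^[i] h) := by
  obtain ⟨J, hJ⟩ := H
  refine ⟨J, fun j hj => ?_⟩
  rw [← Function.iterate_add_apply, ← Function.iterate_add_apply]
  exact hJ _ (by omega)

theorem logClose_of_comp_left (hp : 1 ≤ p.natDegree) {a : ℂ[X]} (ha : 1 ≤ a.natDegree)
    (hf : 1 ≤ f.natDegree) (hfh : f.natDegree = h.natDegree) (hN : N ≤ f.natDegree)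
    (H : BottcherClose p N (a.comp f) (a.comp h)) : LogClose N f h := by
  obtain ⟨J, hJ⟩ := H
  have := hJ J le_rfl
  rw [← iterate_comp_comp, ← iterate_comp_comp] at this
  refine (LogClose.comp_left_iff ?_ hf hfh hN).1 this
  rw [natDegree_iterate_comp]
  exact Nat.mul_pos (pow_pos hp _) ha

end BottcherClose

/-- If words with the same degree are close to order `N` then left factors can be cancelled to
order `N + 1`. -/
theorem BottcherClose.word_left_cancel (hg : ∀ a, 2 ≤ (g a).natDegree) (c : α) {N : ℕ} (hN : 1 ≤ N)
    (H : ∀ u v : List α, (wordPoly g u).natDegree = (wordPoly g v).natDegree →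
      BottcherClose (g c) N (wordPoly g u) (wordPoly g v))
    {w u v : List α} (huv : (wordPoly g u).natDegree = (wordPoly g v).natDegree)
    (hu : u ≠ []) (hv : v ≠ [])
    (hw : BottcherClose (g c) (N + 1) (wordPoly g (w ++ u)) (wordPoly g (w ++ v))) :
    BottcherClose (g c) (N + 1) (wordPoly g u) (wordPoly g v) := by
  have hc : 1 ≤ (g c).natDegree := one_le_two.trans (hg c)
  have swap (j : ℕ) {x : List α} (hx : x ≠ []) :
      BottcherClose (g c) (N + 1) (wordPoly g (w ++ (List.replicate j c ++ x)))
        (wordPoly g (List.replicate j c ++ (w ++ x))) := by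
    rw [← List.append_assoc, ← List.append_assoc, wordPoly_append, wordPoly_append _ x]
    refine (H _ _ ?_).comp_right hN (two_le_natDegree_wordPoly hg hx)
    rw [wordPoly_append, wordPoly_append, natDegree_comp, natDegree_comp, mul_comm]
  refine ⟨N + 1, fun j hj => ?_⟩
  have h₁ := hw.iterate_left j
  rw [← wordPoly_replicate_append, ← wordPoly_replicate_append] at h₁
  have h₂ := ((swap j hu).trans hc (natDegree_wordPoly_pos hg _) h₁).trans hc
    (natDegree_wordPoly_pos hg _) (swap j hv).symm
  rw [← wordPoly_replicate_append, ← wordPoly_replicate_append]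
  rw [wordPoly_append w, wordPoly_append w] at h₂
  refine h₂.logClose_of_comp_left hc (natDegree_wordPoly_pos hg _) (natDegree_wordPoly_pos hg _)
    ?_ ?_
  · rw [wordPoly_append, wordPoly_append, natDegree_comp, natDegree_comp, huv]
  · have := two_pow_length_le_natDegree_wordPoly hg (List.replicate j c ++ u)
    rw [List.length_append, List.length_replicate] at this
    have h2 : j + u.length < 2 ^ (j + u.length) := Nat.lt_two_pow_self
    omega

/-- If any two generators have a common left multiple, then words with the same degree coincide up
to a constant factor in a Böttcher coordinate. -/
theorem bottcherClose_of_natDegree_eq (hg : ∀ a, 2 ≤ (g a).natDegree)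
    (hrel : ∀ a b, a ≠ b → ∃ u v, wordPoly g (u ++ [a]) = wordPoly g (v ++ [b])) (c : α) (N : ℕ)
    (u v : List α) (huv : (wordPoly g u).natDegree = (wordPoly g v).natDegree) :
    BottcherClose (g c) (N + 1) (wordPoly g u) (wordPoly g v) := by
  have hc : 1 ≤ (g c).natDegree := one_le_two.trans (hg c)
  induction N generalizing u v with
  | zero =>
    refine ⟨0, fun j _ => LogClose.one_of_natDegree_eq ?_⟩
    rw [natDegree_iterate_comp, natDegree_iterate_comp, huv]
  | succ N ih =>
    have hN : 1 ≤ N + 1 := by omega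
    rcases List.eq_nil_or_concat' u with rfl | ⟨u', a, rfl⟩
    · rcases eq_or_ne v [] with rfl | hv
      · exact ⟨0, fun j _ => .refl _ _⟩
      · have := two_le_natDegree_wordPoly hg hv
        rw [← huv, wordPoly, natDegree_X] at this
        omega
    rcases List.eq_nil_or_concat' v with rfl | ⟨v', b, rfl⟩
    · have := two_le_natDegree_wordPoly hg (u := u' ++ [a]) (by simp)
      rw [huv, wordPoly, natDegree_X] at this
      omega
    have ha := hg a
    have hb := hg b
    by_cases hab : a = b
    · subst hab
      rw [wordPoly_append, wordPoly_append, wordPoly_singleton]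
      refine (ih _ _ ?_).comp_right hN ha
      rw [wordPoly_append, wordPoly_append, wordPoly_singleton, natDegree_comp, natDegree_comp] at huv
      exact Nat.eq_of_mul_eq_mul_right (by omega) huv
    obtain ⟨x, y, hxy⟩ := hrel a b hab
    -- `x ++ u' ++ [a]`, `u' ++ x ++ [a]`, `u' ++ y ++ [b]` and `x ++ v' ++ [b]` are close.
    refine BottcherClose.word_left_cancel hg c hN ih huv (by simp) (by simp) (w := x) ?_
    have h₁ : BottcherClose (g c) (N + 1 + 1) (wordPoly g (x ++ (u' ++ [a])))
        (wordPoly g (u' ++ (x ++ [a]))) := by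
      rw [← List.append_assoc, ← List.append_assoc, wordPoly_append, wordPoly_append _ [a],
        wordPoly_singleton]
      refine (ih _ _ ?_).comp_right hN ha
      rw [wordPoly_append, wordPoly_append, natDegree_comp, natDegree_comp, mul_comm]
    have h₂ : BottcherClose (g c) (N + 1 + 1) (wordPoly g (u' ++ (y ++ [b])))
        (wordPoly g (x ++ (v' ++ [b]))) := by
      rw [← List.append_assoc, ← List.append_assoc, wordPoly_append, wordPoly_append _ [b],
        wordPoly_singleton]
      refine (ih _ _ ?_).comp_right hN hb
      have hxy' := congrArg natDegree hxy
      simp only [wordPoly_append, wordPoly_singleton, natDegree_comp] at hxy' huv ⊢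
      refine Nat.eq_of_mul_eq_mul_right (show 0 < (g b).natDegree by omega) ?_
      rw [mul_assoc, ← hxy', mul_assoc, ← huv]
      ring
    rw [wordPoly_append u' (x ++ [a]), hxy, ← wordPoly_append] at h₁
    exact h₁.trans hc (natDegree_wordPoly_pos hg _) h₂

theorem not_comp_X_add_C_eq {p : ℂ[X]} (hp : 1 ≤ p.natDegree) {c : ℂ} (hc : c ≠ 0) :
    p.comp (X + C c) ≠ p := by
  intro h
  obtain ⟨z, hz⟩ := IsAlgClosed.exists_root p (by
    rw [degree_eq_natDegree (ne_zero_of_natDegree_gt hp)]; exact_mod_cast (by omega))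
  have hroot (n : ℕ) : p.IsRoot (z + n * c) := by
    induction n with
    | zero => simpa using hz
    | succ n ih =>
      have := congrArg (eval (z + n * c)) h
      rw [eval_comp, eval_add, eval_X, eval_C] at this
      rw [IsRoot.def, ← ih, ← this]
      push_cast
      ring_nf
  have : p = 0 := eq_zero_of_infinite_isRoot p <|
    Set.infinite_of_injective_forall_mem (f := fun n : ℕ => z + n * c)
      (fun m n hmn => by simpa [hc] using hmn) hroot
  rw [this, natDegree_zero] at hp
  omega

/-- Words with the same degree and the same leading coefficient are equal. -/
theorem wordPoly_eq_of_leadingCoeff_eq (hg : ∀ a, 2 ≤ (g a).natDegree)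
    (hrel : ∀ a b, a ≠ b → ∃ u v, wordPoly g (u ++ [a]) = wordPoly g (v ++ [b]))
    {u v : List α} (hu : u ≠ [])
    (hcancel : ∀ a, (g a).comp (wordPoly g u) = (g a).comp (wordPoly g v) →
      wordPoly g u = wordPoly g v)
    (huv : (wordPoly g u).natDegree = (wordPoly g v).natDegree)
    (hlc : (wordPoly g u).leadingCoeff = (wordPoly g v).leadingCoeff) :
    wordPoly g u = wordPoly g v := by
  obtain ⟨c, -⟩ := List.exists_mem_of_ne_nil u hu
  have hc := hg c
  have main {x y : List α} (hxy : (wordPoly g x).natDegree = (wordPoly g y).natDegree)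
      (hlc : (wordPoly g x).leadingCoeff = (wordPoly g y).leadingCoeff)
      (hs : 1 ≤ (wordPoly g x - wordPoly g y).natDegree) : False := by
    have hne : wordPoly g x ≠ wordPoly g y := by
      intro h; rw [h, sub_self, natDegree_zero] at hs; omega
    have hbound := (LogClose.one_of_natDegree_eq hxy).le_of_leadingCoeff_eq hxy hlc hne
    have hclose := bottcherClose_of_natDegree_eq hg hrel c
      ((wordPoly g x).natDegree - (wordPoly g x - wordPoly g y).natDegree) x y hxy
    have h₂ := BottcherClose.logClose_of_comp_left (p := g c) (a := X) (f := wordPoly g x)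
      (h := wordPoly g y)
      (N := (wordPoly g x).natDegree - (wordPoly g x - wordPoly g y).natDegree + 1)
      (one_le_two.trans hc) natDegree_X.ge (natDegree_wordPoly_pos hg x) hxy (by omega)
      (by rw [X_comp, X_comp]; exact hclose)
    have := h₂.le_of_leadingCoeff_eq hxy hlc hne
    omega
  by_contra hne
  have hne' : (g c).comp (wordPoly g u) ≠ (g c).comp (wordPoly g v) := fun h => hne (hcancel c h)
  have hu' := natDegree_wordPoly_pos hg u
  have hv' := natDegree_wordPoly_pos hg v
  have hs : (wordPoly g u - wordPoly g v).natDegree = 0 := by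
    by_contra h
    exact main huv hlc (by omega)
  have hs' : ((g c).comp (wordPoly g u) - (g c).comp (wordPoly g v)).natDegree = 0 := by
    by_contra h
    refine main (x := c :: u) (y := c :: v) ?_ ?_ (Nat.one_le_iff_ne_zero.2 h)
    · simp only [wordPoly, natDegree_comp, huv]
    · simp only [wordPoly]
      rw [leadingCoeff_comp (by omega), leadingCoeff_comp (by omega), hlc]
  obtain ⟨e, he⟩ := natDegree_eq_zero.1 hs
  have hux : wordPoly g u = (X + C e).comp (wordPoly g v) := by
    rw [add_comp, X_comp, C_comp, he]; ring
  have he0 : e ≠ 0 := by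
    rintro rfl
    exact hne (by simpa using hux)
  have hd : derivative (wordPoly g u) = derivative (wordPoly g v) := by
    rw [hux]; simp
  have hd0 : derivative (wordPoly g v) ≠ 0 := fun h => by
    have := derivative_eq_zero.1 h
    omega
  have hd' := derivative_of_natDegree_zero hs'
  rw [derivative_sub, derivative_comp, derivative_comp, hd, ← mul_sub, mul_eq_zero,
    or_iff_right hd0, sub_eq_zero, hux, ← comp_assoc] at hd'
  refine not_comp_X_add_C_eq ?_ he0 (comp_right_cancel hv' hd')
  rw [natDegree_derivative]
  omega

end Words

section FreeCase

open Polynomial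

theorem exists_wordPoly_concat_eq_of_ne {α : Type*} {g : α → ℂ[X]}
    (hg : ∀ a, 2 ≤ (g a).natDegree) {u v : List α} (huv : u ≠ v)
    (h : wordPoly g u = wordPoly g v) :
    ∃ a b, a ≠ b ∧ ∃ x y, wordPoly g (x ++ [a]) = wordPoly g (y ++ [b]) := by
  have nil_of_eq {w : List α} (hw : wordPoly g w = wordPoly g []) : w = [] := by
    by_contra hne
    have := two_le_natDegree_wordPoly hg hne
    rw [hw, wordPoly, natDegree_X] at this
    omega
  induction u using List.reverseRecOn generalizing v with
  | nil => exact absurd (nil_of_eq h.symm).symm huv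
  | append_singleton u a ih =>
    rcases List.eq_nil_or_concat' v with rfl | ⟨v, b, rfl⟩
    · exact absurd (nil_of_eq h) huv
    by_cases hab : a = b
    · subst hab
      refine ih (v := v) (fun e => huv (by rw [e])) ?_
      rw [wordPoly_append, wordPoly_append, wordPoly_singleton] at h
      exact comp_right_cancel (one_le_two.trans (hg a)) h
    · exact ⟨a, b, hab, u, v, h⟩

/-- The pair of polynomials as a family indexed by `Bool`. -/
noncomputable def polyPair (P Q : ℂ[X]) (b : Bool) : ℂ[X] := bif b then P else Q

theorem two_le_natDegree_polyPair {P Q : ℂ[X]} (hP : 2 ≤ P.natDegree) (hQ : 2 ≤ Q.natDegree)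
    (b : Bool) : 2 ≤ (polyPair P Q b).natDegree := by
  cases b <;> assumption

theorem polyGen_polyPair (P Q : ℂ[X]) (b : Bool) : PolyGen {P, Q} (polyPair P Q b) := by
  cases b
  · exact .base (Or.inr rfl)
  · exact .base (Or.inl rfl)

theorem PolyGen.exists_word {P Q p : ℂ[X]} (hp : PolyGen {P, Q} p) :
    ∃ u, u ≠ [] ∧ wordPoly (polyPair P Q) u = p := by
  induction hp with
  | base hp =>
    rcases hp with rfl | rfl
    · exact ⟨[true], by simp, wordPoly_singleton _⟩
    · exact ⟨[false], by simp, wordPoly_singleton _⟩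
  | comp _ _ ih₁ ih₂ =>
    obtain ⟨u, hu, rfl⟩ := ih₁
    obtain ⟨v, -, rfl⟩ := ih₂
    exact ⟨u ++ v, by simp [hu], wordPoly_append u v⟩

theorem freeGroup_mk_map_true_injective (α : Type*) :
    Function.Injective fun u : List α => FreeGroup.mk (u.map fun a => (a, true)) := by
  classical
  intro u v h
  have hred (w : List α) : FreeGroup.reduce (w.map fun a => (a, true)) =
      w.map fun a => (a, true) := by
    apply FreeGroup.IsReduced.reduce_eq
    rw [FreeGroup.IsReduced, List.isChain_map]
    exact (List.pairwise_of_forall fun _ _ _ => rfl).isChain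
  have := FreeGroup.reduce.sound h
  rw [hred, hred] at this
  exact List.map_injective_iff.2 (fun a b hab => (Prod.ext_iff.1 hab).1) this

theorem exists_embedding_of_wordPoly_injective {P Q : ℂ[X]}
    (hinj : Function.Injective (wordPoly (polyPair P Q))) :
    ∃ (G : Type) (_ : Group G) (φ : setOf (PolyGen {P, Q}) → G), Function.Injective φ ∧
      ∀ x y : setOf (PolyGen {P, Q}),
        φ ⟨(x : ℂ[X]).comp (y : ℂ[X]), PolyGen.comp x.2 y.2⟩ = φ x * φ y := by
  choose w hw using fun x : setOf (PolyGen {P, Q}) => x.2.exists_word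
  refine ⟨FreeGroup Bool, inferInstance,
    fun x => FreeGroup.mk ((w x).map fun a => (a, true)), fun x y hxy => ?_, fun x y => ?_⟩
  · have := freeGroup_mk_map_true_injective Bool hxy
    rw [Subtype.ext_iff, ← (hw x).2, ← (hw y).2, this]
  · have hxy : w ⟨_, PolyGen.comp x.2 y.2⟩ = w x ++ w y :=
      hinj (by rw [(hw _).2, wordPoly_append, (hw x).2, (hw y).2])
    simp only [hxy, List.map_append, FreeGroup.mul_mk]

end FreeCase

section MonomialAction

/-- The units killed by a power of `M`. -/
def unitsPowTorsion (M : ℕ) : Subgroup ℂˣ where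
  carrier := {z | ∃ k, z ^ M ^ k = 1}
  one_mem' := ⟨0, one_pow _⟩
  mul_mem' := by
    rintro a b ⟨k, hk⟩ ⟨l, hl⟩
    refine ⟨k + l, ?_⟩
    rw [mul_pow, pow_add, pow_mul a, hk, one_pow, one_mul, mul_comm, pow_mul, hl, one_pow]
  inv_mem' := by
    rintro a ⟨k, hk⟩
    exact ⟨k, by rw [inv_pow, hk, inv_one]⟩

theorem units_pow_surjective {d : ℕ} (hd : 0 < d) (z : ℂˣ) : ∃ y : ℂˣ, y ^ d = z := by
  obtain ⟨y, hy⟩ := IsAlgClosed.exists_pow_nat_eq (z : ℂ) hd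
  have hy0 : y ≠ 0 := by
    rintro rfl
    rw [zero_pow hd.ne'] at hy
    exact z.ne_zero hy.symm
  exact ⟨Units.mk0 y hy0, Units.ext (by simpa using hy)⟩

/-- The units of `ℂ` modulo those killed by a power of `M`. -/
def UnitsModPowTorsion (M : ℕ) : Type := ℂˣ ⧸ unitsPowTorsion M

noncomputable instance (M : ℕ) : CommGroup (UnitsModPowTorsion M) :=
  inferInstanceAs (CommGroup (ℂˣ ⧸ unitsPowTorsion M))

/-- The quotient map. -/
noncomputable def UnitsModPowTorsion.mk (M : ℕ) : ℂˣ →* UnitsModPowTorsion M :=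
  QuotientGroup.mk' (unitsPowTorsion M)

theorem UnitsModPowTorsion.mk_surjective (M : ℕ) : Function.Surjective (mk M) :=
  QuotientGroup.mk'_surjective _

theorem UnitsModPowTorsion.mk_eq_one {M : ℕ} {z : ℂˣ} : mk M z = 1 ↔ ∃ k, z ^ M ^ k = 1 :=
  QuotientGroup.eq_one_iff z

theorem UnitsModPowTorsion.exists_pow_eq_of_mk_eq {M : ℕ} {a b : ℂˣ} (h : mk M a = mk M b) :
    ∃ k, (a : ℂ) ^ M ^ k = (b : ℂ) ^ M ^ k := by
  obtain ⟨k, hk⟩ := mk_eq_one.1 (show mk M (a⁻¹ * b) = 1 by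
    rw [map_mul, map_inv, h, inv_mul_cancel])
  refine ⟨k, ?_⟩
  rw [mul_pow, inv_pow, inv_mul_eq_one] at hk
  exact_mod_cast congrArg Units.val hk

theorem UnitsModPowTorsion.pow_bijective {M d k : ℕ} (hd : 0 < d) (hdM : d ∣ M ^ k) :
    Function.Bijective fun a : UnitsModPowTorsion M => a ^ d := by
  constructor
  · refine (injective_iff_map_eq_one (powMonoidHom (α := UnitsModPowTorsion M) d)).2 fun a ha => ?_
    obtain ⟨z, rfl⟩ := mk_surjective M a
    rw [powMonoidHom_apply, ← map_pow, mk_eq_one] at ha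
    obtain ⟨l, hl⟩ := ha
    obtain ⟨e, he⟩ := hdM
    refine mk_eq_one.2 ⟨k + l, ?_⟩
    rw [pow_add, he, mul_right_comm, pow_mul, pow_mul, hl, one_pow]
  · intro a
    obtain ⟨z, rfl⟩ := mk_surjective M a
    obtain ⟨y, rfl⟩ := units_pow_surjective hd z
    exact ⟨mk M y, (map_pow _ _ _).symm⟩

/-- The permutation `a ↦ c * a ^ d` of the units of `ℂ` modulo torsion, where `c` and `d` are the
leading coefficient and the degree of `p`. -/
noncomputable def monomialPerm (M : ℕ) (p : Polynomial ℂ) (hp : 1 ≤ p.natDegree)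
    (hM : ∃ k, p.natDegree ∣ M ^ k) : Equiv.Perm (UnitsModPowTorsion M) :=
  Equiv.ofBijective
    (fun a => UnitsModPowTorsion.mk M (Units.mk0 p.leadingCoeff
      (Polynomial.leadingCoeff_ne_zero.2 (Polynomial.ne_zero_of_natDegree_gt hp))) *
        a ^ p.natDegree)
    ((Group.mulLeft_bijective _).comp (UnitsModPowTorsion.pow_bijective hp hM.choose_spec))

end MonomialAction

section Embedding

open Polynomial

theorem PolyGen.two_le_natDegree {P Q p : ℂ[X]} (hP : 2 ≤ P.natDegree) (hQ : 2 ≤ Q.natDegree)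
    (hp : PolyGen {P, Q} p) : 2 ≤ p.natDegree := by
  obtain ⟨u, hu, rfl⟩ := hp.exists_word
  exact two_le_natDegree_wordPoly (two_le_natDegree_polyPair hP hQ) hu

theorem PolyGen.exists_natDegree_dvd_pow {P Q p : ℂ[X]} (hp : PolyGen {P, Q} p) :
    ∃ k, p.natDegree ∣ (P.natDegree * Q.natDegree) ^ k := by
  induction hp with
  | base hp =>
    refine ⟨1, ?_⟩
    rcases hp with rfl | rfl
    · simp
    · simp
  | comp _ _ ih₁ ih₂ =>
    obtain ⟨k, hk⟩ := ih₁
    obtain ⟨l, hl⟩ := ih₂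
    exact ⟨k + l, by rw [natDegree_comp, pow_add]; exact mul_dvd_mul hk hl⟩

theorem exists_polyGen_pow_dvd_natDegree (P Q : ℂ[X]) (k : ℕ) :
    ∃ h, PolyGen {P, Q} h ∧ (P.natDegree * Q.natDegree) ^ k ∣ h.natDegree := by
  have hP : PolyGen {P, Q} P := .base (Or.inl rfl)
  have hQ : PolyGen {P, Q} Q := .base (Or.inr rfl)
  induction k with
  | zero => exact ⟨P, hP, by simp⟩
  | succ k ih =>
    obtain ⟨h, hh, hk⟩ := ih
    refine ⟨h.comp (P.comp Q), hh.comp (hP.comp hQ), ?_⟩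
    rw [natDegree_comp, natDegree_comp, pow_succ]
    exact mul_dvd_mul_right hk _

theorem monomialPerm_comp {M : ℕ} {p q : ℂ[X]} (hp : 1 ≤ p.natDegree) (hq : 1 ≤ q.natDegree)
    (hpq : 1 ≤ (p.comp q).natDegree) (hp' : ∃ k, p.natDegree ∣ M ^ k)
    (hq' : ∃ k, q.natDegree ∣ M ^ k) (hpq' : ∃ k, (p.comp q).natDegree ∣ M ^ k) :
    monomialPerm M (p.comp q) hpq hpq' = monomialPerm M p hp hp' * monomialPerm M q hq hq' := by
  ext a
  have hu : Units.mk0 (p.comp q).leadingCoeff (leadingCoeff_ne_zero.2 (ne_zero_of_natDegree_gt hpq))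
      = Units.mk0 p.leadingCoeff (leadingCoeff_ne_zero.2 (ne_zero_of_natDegree_gt hp)) *
        Units.mk0 q.leadingCoeff (leadingCoeff_ne_zero.2 (ne_zero_of_natDegree_gt hq))
          ^ p.natDegree := by
    ext
    simp [leadingCoeff_comp (show q.natDegree ≠ 0 by omega)]
  simp only [monomialPerm, Equiv.ofBijective_apply, Equiv.Perm.mul_apply, hu, natDegree_comp,
    map_mul, map_pow, mul_pow, ← pow_mul, mul_assoc, mul_comm q.natDegree]

theorem exists_pow_eq_of_monomialPerm_eq {M : ℕ} (hM : 0 < M) {p q : ℂ[X]}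
    (hp : 1 ≤ p.natDegree) (hq : 1 ≤ q.natDegree) (hp' : ∃ k, p.natDegree ∣ M ^ k)
    (hq' : ∃ k, q.natDegree ∣ M ^ k) (h : monomialPerm M p hp hp' = monomialPerm M q hq hq') :
    p.natDegree = q.natDegree ∧ ∃ k, p.leadingCoeff ^ M ^ k = q.leadingCoeff ^ M ^ k := by
  have happ (a : UnitsModPowTorsion M) := Equiv.congr_fun h a
  simp only [monomialPerm, Equiv.ofBijective_apply] at happ
  have h1 := happ 1
  rw [one_pow, one_pow, mul_one, mul_one] at h1
  refine ⟨?_, UnitsModPowTorsion.exists_pow_eq_of_mk_eq h1⟩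
  have h2 := happ (.mk M (Units.mk0 (2 : ℂ) two_ne_zero))
  rw [h1, mul_right_inj, ← map_pow, ← map_pow] at h2
  obtain ⟨k, hk⟩ := UnitsModPowTorsion.exists_pow_eq_of_mk_eq h2
  simp only [Units.val_pow_eq_pow_val, Units.val_mk0, ← pow_mul] at hk
  have hk' : 2 ^ (p.natDegree * M ^ k) = 2 ^ (q.natDegree * M ^ k) := by exact_mod_cast hk
  exact Nat.eq_of_mul_eq_mul_right (pow_pos hM k) (Nat.pow_right_injective le_rfl hk')

theorem exists_embedding_of_not_wordPoly_injective {P Q : ℂ[X]} (hP : 2 ≤ P.natDegree)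
    (hQ : 2 ≤ Q.natDegree) (hcanc : PolyLeftCancellative (setOf (PolyGen {P, Q})))
    (hinj : ¬ Function.Injective (wordPoly (polyPair P Q))) :
    ∃ (G : Type) (_ : Group G) (φ : setOf (PolyGen {P, Q}) → G), Function.Injective φ ∧
      ∀ x y : setOf (PolyGen {P, Q}),
        φ ⟨(x : ℂ[X]).comp (y : ℂ[X]), PolyGen.comp x.2 y.2⟩ = φ x * φ y := by
  have hg := two_le_natDegree_polyPair hP hQ
  have hrel : ∀ a b, a ≠ b → ∃ u v, wordPoly (polyPair P Q) (u ++ [a]) =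
      wordPoly (polyPair P Q) (v ++ [b]) := by
    simp only [Function.Injective, not_forall] at hinj
    obtain ⟨u, v, huv, hne⟩ := hinj
    obtain ⟨a, b, hab, x, y, hxy⟩ := exists_wordPoly_concat_eq_of_ne hg hne huv
    intro a' b' hab'
    cases a <;> cases b <;> cases a' <;> cases b' <;>
      first
      | exact absurd rfl hab
      | exact absurd rfl hab'
      | exact ⟨x, y, hxy⟩
      | exact ⟨y, x, hxy.symm⟩
  have heq {p q : ℂ[X]} (hp : PolyGen {P, Q} p) (hq : PolyGen {P, Q} q)
      (hdeg : p.natDegree = q.natDegree) (hlc : p.leadingCoeff = q.leadingCoeff) : p = q := by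
    obtain ⟨u, hu, rfl⟩ := hp.exists_word
    obtain ⟨v, -, rfl⟩ := hq.exists_word
    exact wordPoly_eq_of_leadingCoeff_eq hg hrel hu
      (fun a h => hcanc _ (polyGen_polyPair P Q a) _ hp _ hq h) hdeg hlc
  have hdeg (x : setOf (PolyGen {P, Q})) : 1 ≤ (x : ℂ[X]).natDegree :=
    one_le_two.trans (x.2.two_le_natDegree hP hQ)
  refine ⟨Equiv.Perm (UnitsModPowTorsion (P.natDegree * Q.natDegree)), inferInstance,
    fun x => monomialPerm _ x (hdeg x) x.2.exists_natDegree_dvd_pow, fun x y hxy => ?_, fun x y => monomialPerm_comp _ _ _ _ _ _⟩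
  obtain ⟨hd, k, hk⟩ := exists_pow_eq_of_monomialPerm_eq
    (Nat.mul_pos (by omega) (by omega)) _ _ _ _ hxy
  obtain ⟨h, hh, e, he⟩ := exists_polyGen_pow_dvd_natDegree P Q k
  refine Subtype.ext (hcanc h hh x x.2 y y.2 (heq (hh.comp x.2) (hh.comp y.2) ?_ ?_))
  · rw [natDegree_comp, natDegree_comp, hd]
  · have hx := hdeg x
    have hy := hdeg y
    rw [leadingCoeff_comp (by omega), leadingCoeff_comp (by omega), he, pow_mul, hk, ← pow_mul]

end Embedding

/-- Let `P` and `Q` be complex polynomials of degree at least 2 (so they share the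
superattracting fixed point at infinity). If the semigroup generated by `P` and `Q`
under composition is cancellative, then it is embeddable into a group. -/
theorem cancellative_two_generated_embeddable
    (P Q : Polynomial ℂ) (hP : 2 ≤ P.natDegree) (hQ : 2 ≤ Q.natDegree)
    (hcanc : PolyCancellative (setOf (PolyGen {P, Q}))) :
    ∃ (G : Type) (_ : Group G) (φ : setOf (PolyGen {P, Q}) → G), Function.Injective φ ∧
      ∀ x y : setOf (PolyGen {P, Q}),
        φ ⟨(x : Polynomial ℂ).comp (y : Polynomial ℂ), PolyGen.comp x.2 y.2⟩ =
          φ x * φ y := by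
  by_cases hinj : Function.Injective (wordPoly (polyPair P Q))
  · exact exists_embedding_of_wordPoly_injective hinj
  · exact exists_embedding_of_not_wordPoly_injective hP hQ hcanc.1 hinj
end

section
/- A non-exceptional semigroup S of polynomials is right amenable if and only if S contains no free subsemigroup of rank 2. -/
open Polynomial Filter Topology

/-- Iterated Cesàro average of `f` along the powers of `d 0, …, d (n - 1)`. -/
noncomputable def iterAvg {M : Type*} [CommMonoid M] (d : ℕ → M) (K : ℕ) (f : M → ℝ) :
    ℕ → M → ℝ
  | 0 => f
  | n + 1 => fun x => (∑ t ∈ Finset.range K, iterAvg d K f n (d n ^ t * x)) / K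

section
variable {M : Type*} [CommMonoid M] (d : ℕ → M) (K : ℕ)

theorem iterAvg_add (f g : M → ℝ) (n : ℕ) :
    iterAvg d K (f + g) n = iterAvg d K f n + iterAvg d K g n := by
  induction n with
  | zero => rfl
  | succ n ih =>
    funext x
    simp [iterAvg, ih, Finset.sum_add_distrib, add_div]

theorem iterAvg_smul (c : ℝ) (f : M → ℝ) (n : ℕ) :
    iterAvg d K (c • f) n = c • iterAvg d K f n := by
  induction n with
  | zero => rfl
  | succ n ih =>
    funext x
    simp [iterAvg, ih, ← Finset.mul_sum, mul_div_assoc]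

theorem iterAvg_nonneg {f : M → ℝ} (hf : ∀ x, 0 ≤ f x) (n : ℕ) (x : M) :
    0 ≤ iterAvg d K f n x := by
  induction n generalizing x with
  | zero => exact hf x
  | succ n ih => exact div_nonneg (Finset.sum_nonneg fun t _ => ih _) K.cast_nonneg

theorem abs_sum_range_div_le {u : ℕ → ℝ} {C : ℝ} (hK : 0 < K) (hu : ∀ t, |u t| ≤ C) :
    |(∑ t ∈ Finset.range K, u t) / K| ≤ C := by
  have hK' : (0 : ℝ) < K := Nat.cast_pos.mpr hK
  rw [abs_div, abs_of_pos hK', div_le_iff₀ hK']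
  calc |∑ t ∈ Finset.range K, u t| ≤ ∑ t ∈ Finset.range K, |u t| := Finset.abs_sum_le_sum_abs _ _
    _ ≤ ∑ _t ∈ Finset.range K, C := Finset.sum_le_sum fun t _ => hu t
    _ = C * K := by simp [mul_comm]

theorem abs_iterAvg_le (hK : 0 < K) {f : M → ℝ} {C : ℝ} (hf : ∀ x, |f x| ≤ C) (n : ℕ) (x : M) :
    |iterAvg d K f n x| ≤ C := by
  induction n generalizing x with
  | zero => exact hf x
  | succ n ih => exact abs_sum_range_div_le K hK fun t => ih _

theorem iterAvg_one (hK : 0 < K) (n : ℕ) : iterAvg d K (fun _ => (1 : ℝ)) n = fun _ => 1 := by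
  have hK' : (K : ℝ) ≠ 0 := Nat.cast_ne_zero.mpr hK.ne'
  induction n with
  | zero => rfl
  | succ n ih => funext x; simp [iterAvg, ih, hK']

theorem iterAvg_translate (f : M → ℝ) (c : M) (n : ℕ) (x : M) :
    iterAvg d K (fun y => f (c * y)) n x = iterAvg d K f n (c * x) := by
  induction n generalizing x with
  | zero => rfl
  | succ n ih => simp only [iterAvg, ih, mul_left_comm]

theorem abs_iterAvg_translate_sub_le (hK : 0 < K) {f : M → ℝ} {C : ℝ} (hf : ∀ x, |f x| ≤ C)
    {j n : ℕ} (hj : j < n) (x : M) :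
    |iterAvg d K f n (d j * x) - iterAvg d K f n x| ≤ 2 * C / K := by
  induction n generalizing x with
  | zero => omega
  | succ n ih =>
    have hsub : iterAvg d K f (n + 1) (d j * x) - iterAvg d K f (n + 1) x =
        (∑ t ∈ Finset.range K, (iterAvg d K f n (d j * (d n ^ t * x)) -
          iterAvg d K f n (d n ^ t * x))) / K := by
      simp only [iterAvg, Finset.sum_sub_distrib, sub_div, mul_left_comm]
    rw [hsub]
    rcases Nat.lt_succ_iff_lt_or_eq.mp hj with h | rfl
    · exact abs_sum_range_div_le K hK fun t => ih h _
    · have htel := Finset.sum_range_sub (fun t => iterAvg d K f j (d j ^ t * x)) K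
      simp only [pow_succ', mul_assoc] at htel
      rw [htel, abs_div, abs_of_pos (Nat.cast_pos.mpr hK : (0 : ℝ) < K)]
      gcongr
      have h1 := abs_iterAvg_le d K hK hf j (d j ^ K * x)
      have h2 := abs_iterAvg_le d K hK hf j (d j ^ 0 * x)
      exact abs_le.mpr ⟨by linarith [(abs_le.mp h1).1, (abs_le.mp h2).2],
        by linarith [(abs_le.mp h1).2, (abs_le.mp h2).1]⟩

end

/-- Every countable commutative monoid carries an invariant mean. -/
theorem exists_invariant_mean_of_countable (M : Type*) [CommMonoid M] [Countable M] :
    ∃ m : Mean M, ∀ (c : M) (f : M → ℝ), Bdd f → m.toFun (fun x => f (c * x)) = m.toFun f := by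
  obtain ⟨d, hd⟩ := exists_surjective_nat M
  let a : (M → ℝ) → ℕ → ℝ := fun f k => iterAvg d (k + 1) f k 1
  let L : (M → ℝ) → ℝ := fun f => limUnder (hyperfilter ℕ : Filter ℕ) (a f)
  have hL : ∀ f, Bdd f → Tendsto (a f) (hyperfilter ℕ) (𝓝 (L f)) := by
    rintro f ⟨C, hC⟩
    apply tendsto_nhds_limUnder
    have hmem : ∀ k, a f k ∈ Set.Icc (-C) C := fun k =>
      abs_le.mp (abs_iterAvg_le d _ k.succ_pos hC k 1)
    obtain ⟨y, -, hy⟩ := (isCompact_Icc (a := -C) (b := C)).ultrafilter_le_nhds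
      ((hyperfilter ℕ).map (a f))
      (tendsto_principal.mpr (Eventually.of_forall hmem))
    exact ⟨y, hy⟩
  have huniq : ∀ {f l}, Bdd f → Tendsto (a f) (hyperfilter ℕ) (𝓝 l) → L f = l :=
    fun hf h => tendsto_nhds_unique (hL _ hf) h
  refine ⟨⟨L, ?_, ?_, ?_, ?_⟩, ?_⟩
  · rintro f g hf hg
    have hfg : Bdd (f + g) := by
      obtain ⟨C, hC⟩ := hf
      obtain ⟨D, hD⟩ := hg
      exact ⟨C + D, fun s => (abs_add_le _ _).trans (add_le_add (hC s) (hD s))⟩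
    refine huniq hfg (((hL f hf).add (hL g hg)).congr fun k => ?_)
    simp [a, iterAvg_add]
  · rintro c f hf
    have hcf : Bdd (c • f) := by
      obtain ⟨C, hC⟩ := hf
      refine ⟨|c| * C, fun s => ?_⟩
      rw [Pi.smul_apply, smul_eq_mul, abs_mul]
      exact mul_le_mul_of_nonneg_left (hC s) (abs_nonneg c)
    refine huniq hcf (((hL f hf).const_mul c).congr fun k => ?_)
    simp [a, iterAvg_smul]
  · intro f hf h0
    exact ge_of_tendsto' (hL f hf) fun k => iterAvg_nonneg d _ h0 k 1
  · refine huniq ⟨1, by simp⟩ (tendsto_const_nhds.congr fun k => ?_)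
    simp [a, iterAvg_one d (k + 1) k.succ_pos]
  · intro c f hf
    obtain ⟨C, hC⟩ := hf
    have hf' : Bdd fun x => f (c * x) := ⟨C, fun s => hC _⟩
    obtain ⟨j, rfl⟩ := hd c
    have hdiff : Tendsto (fun k => a (fun x => f (d j * x)) k - a f k) atTop (𝓝 0) := by
      have hz : Tendsto (fun k : ℕ => 2 * C / ((k + 1 : ℕ) : ℝ)) atTop (𝓝 0) :=
        (tendsto_const_nhds.div_atTop tendsto_natCast_atTop_atTop).comp (tendsto_add_atTop_nat 1)
      refine squeeze_zero_norm' ?_ hz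
      filter_upwards [eventually_gt_atTop j] with k hk
      simp only [a, iterAvg_translate, Real.norm_eq_abs]
      exact abs_iterAvg_translate_sub_le d (k + 1) k.succ_pos hC hk 1
    have hdiff' := hdiff.mono_left (Nat.hyperfilter_le_atTop)
    refine huniq hf' ?_
    simpa using hdiff'.add (hL f ⟨C, hC⟩)

theorem comp_right_cancel_s17 {P Q h : ℂ[X]} (hh : 0 < h.natDegree) (e : P.comp h = Q.comp h) : P = Q := by
  have h0 : (P - Q).comp h = 0 := by rw [sub_comp, e, sub_self]
  rcases comp_eq_zero_iff.mp h0 with h1 | ⟨_, h2⟩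
  · exact sub_eq_zero.mp h1
  · rw [h2] at hh; simp at hh

theorem eq_affine_of_comp_eq {U V A B : ℂ[X]} (hU : 0 < U.natDegree) (hA : 0 < A.natDegree)
    (hAB : A.natDegree = B.natDegree) (h : U.comp A = V.comp B) :
    ∃ c e : ℂ, c ≠ 0 ∧ A = C c * B + C e := by
  have hB : 0 < B.natDegree := hAB ▸ hA
  have hA0 : A.leadingCoeff ≠ 0 := leadingCoeff_ne_zero.mpr (ne_zero_of_natDegree_gt hA)
  have hB0 : B.leadingCoeff ≠ 0 := leadingCoeff_ne_zero.mpr (ne_zero_of_natDegree_gt hB)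
  have hU0 : U.leadingCoeff ≠ 0 := leadingCoeff_ne_zero.mpr (ne_zero_of_natDegree_gt hU)
  have hUV : U.natDegree = V.natDegree := by
    have := congrArg natDegree h
    rw [natDegree_comp, natDegree_comp, ← hAB] at this
    exact Nat.eq_of_mul_eq_mul_right hA this
  obtain ⟨e, he⟩ : ∃ e, U.natDegree = e + 1 := ⟨_, (Nat.succ_pred_eq_of_pos hU).symm⟩
  set d := A.natDegree with hd
  set c := A.leadingCoeff / B.leadingCoeff with hc
  have hlead : U.leadingCoeff * A.leadingCoeff ^ (e + 1)
      = V.leadingCoeff * B.leadingCoeff ^ (e + 1) := by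
    have := congrArg leadingCoeff h
    rwa [leadingCoeff_comp hA.ne', leadingCoeff_comp hB.ne', ← hUV, he] at this
  have hV : V.leadingCoeff = U.leadingCoeff * c ^ (e + 1) := by
    rw [hc, div_pow]; field_simp; exact hlead.symm
  have key : ∀ W : ℂ[X], W.natDegree = e + 1 → ∀ D : ℂ[X], D.natDegree = d →
      ∃ R : ℂ[X], R.natDegree ≤ e * d ∧ W.comp D = C W.leadingCoeff * D ^ (e + 1) + R := by
    intro W hW D hD
    refine ⟨W.eraseLead.comp D, ?_, ?_⟩
    · rw [natDegree_comp, hD]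
      exact Nat.mul_le_mul_right _ (by have := eraseLead_natDegree_le W; omega)
    · conv_lhs => rw [← eraseLead_add_C_mul_X_pow W]
      simp [hW, add_comm]
  obtain ⟨R₁, hR₁, e₁⟩ := key U he A rfl
  obtain ⟨R₂, hR₂, e₂⟩ := key V (hUV ▸ he) B hAB.symm
  set G := ∑ i ∈ Finset.range (e + 1), A ^ i * (C c * B) ^ (e + 1 - 1 - i) with hG
  have hcB : (C c * B).natDegree ≤ d := (natDegree_C_mul_le _ _).trans hAB.ge
  have hcBl : (C c * B).coeff d = A.leadingCoeff := by
    rw [coeff_C_mul, hAB, coeff_natDegree, hc]; field_simp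
  have hGc : G.coeff (e * d) = (e + 1) * A.leadingCoeff ^ e := by
    rw [hG, finsetSum_coeff, Finset.sum_congr rfl (g := fun _ => A.leadingCoeff ^ e)]
    · simp
    · intro i hi
      have hi' : i ≤ e := Nat.lt_succ_iff.mp (Finset.mem_range.mp hi)
      have : e * d = i * d + (e + 1 - 1 - i) * d := by
        rw [← add_mul]; congr 1; omega
      rw [this, coeff_mul_add_eq_of_natDegree_le (natDegree_pow_le_of_le i le_rfl)
        (natDegree_pow_le_of_le _ hcB), coeff_pow_of_natDegree_le le_rfl,
        coeff_pow_of_natDegree_le hcB, hcBl, coeff_natDegree, ← pow_add]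
      congr 1; omega
  have hGd : e * d ≤ G.natDegree := by
    apply le_natDegree_of_ne_zero
    rw [hGc]
    exact mul_ne_zero (by exact_mod_cast Nat.succ_ne_zero e) (pow_ne_zero _ hA0)
  have hprod : C U.leadingCoeff * (G * (A - C c * B)) = R₂ - R₁ := by
    rw [hG, geom_sum₂_mul]
    rw [e₁, e₂, hV] at h
    simp only [map_mul, map_pow] at h
    rw [mul_pow]
    linear_combination h
  have hconst : (A - C c * B).natDegree = 0 := by
    by_cases hz : A - C c * B = 0
    · rw [hz]; simp
    have hG0 : G ≠ 0 := by
      intro h0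
      rw [h0, coeff_zero] at hGc
      exact (mul_ne_zero (by exact_mod_cast Nat.succ_ne_zero e) (pow_ne_zero _ hA0)) hGc.symm
    have h1 : (R₂ - R₁).natDegree ≤ e * d := (natDegree_sub_le _ _).trans (max_le hR₂ hR₁)
    rw [← hprod, natDegree_C_mul hU0, natDegree_mul hG0 hz] at h1
    omega
  refine ⟨c, (A - C c * B).coeff 0, div_ne_zero hA0 hB0, ?_⟩
  rw [← eq_C_of_natDegree_eq_zero hconst]; ring

/-- An affine symmetry of `h` permutes its critical points. -/
theorem card_affine_symm_le (h : ℂ[X]) {x y : ℂ} (hxy : x ≠ y)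
    (hx : h.derivative.IsRoot x) (hy : h.derivative.IsRoot y) (hh : h.derivative ≠ 0)
    (G : Set (ℂ × ℂ))
    (hG : ∀ p ∈ G, p.1 ≠ 0 ∧ ∃ c e : ℂ, h.comp (C p.1 * X + C p.2) = C c * h + C e) :
    G.Finite ∧ G.ncard ≤ (h.derivative.roots.toFinset.card) ^ 2 := by
  classical
  set R := h.derivative.roots.toFinset
  have hmap : ∀ p ∈ G, ∀ z, h.derivative.IsRoot z → p.1 * z + p.2 ∈ R := by
    intro p hp z hz
    obtain ⟨h0, c, e, he⟩ := hG p hp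
    have := congrArg (fun q => (derivative q).eval z) he
    simp only [derivative_comp, eval_mul, derivative_add, derivative_mul, derivative_C,
      derivative_X, eval_comp, eval_add, eval_C, eval_X, hz.eq_zero] at this
    simp [h0] at this
    simp [R, hh, this]
  let φ : ℂ × ℂ → ℂ × ℂ := fun p => (p.1 * x + p.2, p.1 * y + p.2)
  have hφ : Function.Injective φ := by
    rintro ⟨a, b⟩ ⟨a', b'⟩ heq
    simp only [φ, Prod.mk.injEq] at heq
    have h1 : (a - a') * (x - y) = 0 := by linear_combination heq.1 - heq.2
    have h2 : a = a' := sub_eq_zero.mp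
      ((mul_eq_zero.mp h1).resolve_right (sub_ne_zero.mpr hxy))
    subst h2
    simpa using heq.1
  have hsub : φ '' G ⊆ ((R ×ˢ R : Finset (ℂ × ℂ)) : Set (ℂ × ℂ)) := by
    rintro _ ⟨p, hp, rfl⟩
    simp only [φ, Finset.coe_product, Set.mem_prod, Finset.mem_coe]
    exact ⟨hmap p hp x hx, hmap p hp y hy⟩
  refine ⟨((Finset.finite_toSet _).subset hsub).of_finite_image hφ.injOn, ?_⟩
  rw [← Set.ncard_image_of_injective G hφ]
  refine (Set.ncard_le_ncard hsub (Finset.finite_toSet _)).trans ?_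
  rw [Set.ncard_coe_finset, Finset.card_product, sq]

theorem eq_C_mul_X_sub_C_pow_add_C {P : ℂ[X]} {x : ℂ} (hP : 0 < P.natDegree)
    (h : ∀ z, P.derivative.IsRoot z → z = x) :
    ∃ a e : ℂ, a ≠ 0 ∧ P = C a * (X - C x) ^ P.natDegree + C e := by
  set n := P.natDegree with hn
  have hd : P.derivative.natDegree = n - 1 := natDegree_derivative P
  have hd0 : P.derivative ≠ 0 := fun h0 => hP.ne' (derivative_eq_zero.mp h0)
  have hs := IsAlgClosed.splits P.derivative
  have hroots : P.derivative.roots = Multiset.replicate (n - 1) x := by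
    rw [Multiset.eq_replicate]
    refine ⟨by rw [← hd]; exact hs.natDegree_eq_card_roots.symm, fun z hz => h z (isRoot_of_mem_roots hz)⟩
  have hfac : P.derivative = C P.derivative.leadingCoeff * (X - C x) ^ (n - 1) := by
    conv_lhs => rw [hs.eq_prod_roots, hroots]
    simp
  set k := P.derivative.leadingCoeff
  have hk : k ≠ 0 := leadingCoeff_ne_zero.mpr hd0
  have hn0 : (n : ℂ) ≠ 0 := Nat.cast_ne_zero.mpr hP.ne'
  have hc : (P - C (k / n) * (X - C x) ^ n).natDegree = 0 := by
    apply derivative_eq_zero.mp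
    rw [derivative_sub, hfac, derivative_C_mul, derivative_X_sub_C_pow, ← mul_assoc,
      ← C_mul, div_mul_cancel₀ _ hn0, sub_self]
  refine ⟨k / n, (P - C (k / n) * (X - C x) ^ n).coeff 0, div_ne_zero hk hn0, ?_⟩
  rw [← eq_C_of_natDegree_eq_zero hc]; ring

theorem exists_two_critical_points_comp_self {P : ℂ[X]} (hP : ¬ IsExceptional P) :
    ∃ x y, x ≠ y ∧ (P.comp P).derivative.IsRoot x ∧ (P.comp P).derivative.IsRoot y := by
  have hdeg : 2 ≤ P.natDegree := by
    by_contra hlt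
    exact hP (Or.inl (by omega))
  by_contra! hall
  have hder : ∀ z, (P.comp P).derivative.eval z =
      P.derivative.eval z * P.derivative.eval (P.eval z) := fun z => by
    simp [derivative_comp]
  obtain ⟨x, hx⟩ : ∃ x, P.derivative.IsRoot x := by
    refine IsAlgClosed.exists_root _ fun h => ?_
    have h1 := natDegree_derivative P
    have h2 := natDegree_eq_zero_iff_degree_le_zero.mpr h.le
    omega
  have hx2 : (P.comp P).derivative.IsRoot x := by simp [IsRoot, hder, hx.eq_zero]
  obtain ⟨a, e, ha, hPe⟩ := eq_C_mul_X_sub_C_pow_add_C (P := P) (x := x) (by omega) fun z hz => by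
    by_contra hne
    exact hall z x hne (by simp [IsRoot, hder, hz.eq_zero]) hx2
  obtain ⟨w, hw⟩ : ∃ w, (P - C x).IsRoot w := by
    refine IsAlgClosed.exists_root _ fun h => ?_
    have h2 := natDegree_eq_zero_iff_degree_le_zero.mpr h.le
    rw [natDegree_sub_C] at h2
    omega
  have hw' : P.eval w = x := by simpa [sub_eq_zero] using hw
  have hwx : w = x := by
    by_contra hne
    exact hall w x hne (by simp [IsRoot, hder, hw', hx.eq_zero]) hx2
  set n := P.natDegree with hn
  have hex : e = x := by
    rw [hwx, hPe] at hw'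
    simpa [show n ≠ 0 by omega] using hw'
  obtain ⟨s, hs⟩ := IsAlgClosed.exists_pow_nat_eq a (show 0 < n - 1 by omega)
  have hs0 : s ≠ 0 := by
    rintro rfl
    rw [zero_pow (by omega)] at hs
    exact ha hs.symm
  refine hP (Or.inr ⟨s, -(s * x), hs0, Or.inl ?_⟩)
  rw [← hn]
  refine Polynomial.funext fun z => ?_
  have hsn : s ^ n = a * s := by rw [← hs, ← pow_succ]; congr 1; omega
  rw [affConj, hPe]
  simp only [eval_comp, eval_add, eval_mul, eval_sub, eval_pow, eval_C, eval_X, hex]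
  rw [show s⁻¹ * (z - -(s * x)) - x = s⁻¹ * z by field_simp; ring, mul_pow, inv_pow, hsn]
  field_simp
  ring

/-- Any two elements of `S` have a common left multiple in `S`. -/
def LeftReversible (S : Set ℂ[X]) : Prop :=
  ∀ A ∈ S, ∀ B ∈ S, ∃ U ∈ S, ∃ V ∈ S, U.comp A = V.comp B

theorem LeftReversible.exists_affine {S : Set ℂ[X]} (hR : LeftReversible S)
    (hdeg : ∀ p ∈ S, 0 < p.natDegree) {A B : ℂ[X]} (hA : A ∈ S) (hB : B ∈ S)
    (hAB : A.natDegree = B.natDegree) : ∃ c e : ℂ, c ≠ 0 ∧ A = C c * B + C e := by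
  obtain ⟨U, hU, V, -, h⟩ := hR A hA B hB
  exact eq_affine_of_comp_eq (hdeg U hU) (hdeg A hA) hAB h

/-- If `h` has two distinct critical points, then the elements of a given degree in a
left reversible semigroup containing `h` are boundedly many. -/
theorem LeftReversible.exists_card_degree_le {S : Set ℂ[X]} (hR : LeftReversible S)
    (hdeg : ∀ p ∈ S, 0 < p.natDegree) (hcomp : ∀ p ∈ S, ∀ q ∈ S, p.comp q ∈ S)
    {h : ℂ[X]} (hS : h ∈ S) {x y : ℂ} (hxy : x ≠ y)
    (hx : h.derivative.IsRoot x) (hy : h.derivative.IsRoot y) :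
    ∃ N : ℕ, ∀ d, {p | p ∈ S ∧ p.natDegree = d}.Finite ∧
      {p | p ∈ S ∧ p.natDegree = d}.ncard ≤ N := by
  have hh := hdeg h hS
  have hh' : h.derivative ≠ 0 := fun h0 => hh.ne' (derivative_eq_zero.mp h0)
  let G : Set (ℂ × ℂ) :=
    {p | p.1 ≠ 0 ∧ ∃ c e : ℂ, h.comp (C p.1 * X + C p.2) = C c * h + C e}
  obtain ⟨hGf, hGc⟩ := card_affine_symm_le h hxy hx hy hh' G fun p hp => hp
  refine ⟨h.derivative.roots.toFinset.card ^ 2, fun d => ?_⟩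
  rcases Set.eq_empty_or_nonempty {p | p ∈ S ∧ p.natDegree = d} with hE | ⟨A, hA, hAd⟩
  · rw [hE]; simp
  have hsub : {p | p ∈ S ∧ p.natDegree = d} ⊆ (fun p : ℂ × ℂ => C p.1 * A + C p.2) '' G := by
    rintro A' ⟨hA', hA'd⟩
    have hB₁ := hcomp A hA h hS
    have hB₂ := hcomp A' hA' h hS
    have hBB : (A'.comp h).natDegree = (A.comp h).natDegree := by
      rw [natDegree_comp, natDegree_comp, hAd, hA'd]
    obtain ⟨c, e, hc, h₁⟩ := hR.exists_affine hdeg hB₂ hB₁ hBB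
    obtain ⟨c₂, e₂, -, h₂⟩ := hR.exists_affine hdeg (hcomp _ hB₂ _ hB₂) (hcomp _ hB₁ _ hB₁)
      (by rw [natDegree_comp, hBB, ← natDegree_comp])
    have hA'eq : A' = C c * A + C e :=
      comp_right_cancel_s17 hh (by simpa using h₁)
    refine ⟨(c, e), ⟨hc, ?_⟩, hA'eq.symm⟩
    set B := A.comp h with hB
    have h₃ : C c * B.comp (C c * X + C e) + C e = C c₂ * B + C e₂ := by
      refine comp_right_cancel_s17 (hdeg B hB₁) ?_
      rw [h₁] at h₂
      simpa [comp_assoc] using h₂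
    have h₄ : A.comp (h.comp (C c * X + C e)) =
        (C (c₂ / c) * A + C ((e₂ - e) / c)).comp h := by
      have hCc : (C c : ℂ[X]) ≠ 0 := C_ne_zero.mpr hc
      refine mul_left_cancel₀ hCc ?_
      rw [← comp_assoc, ← hB, add_comp, mul_comp, C_comp, C_comp, ← hB, mul_add, ← mul_assoc,
        ← C_mul, ← C_mul, mul_div_cancel₀ _ hc, mul_div_cancel₀ _ hc, C_sub]
      linear_combination h₃
    obtain ⟨c', e', -, h₅⟩ := eq_affine_of_comp_eq (hdeg A hA)
      (by rw [natDegree_comp, natDegree_linear hc, mul_one]; exact hh)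
      (by rw [natDegree_comp, natDegree_linear hc, mul_one]) h₄
    exact ⟨c', e', h₅⟩
  exact ⟨(hGf.image _).subset hsub, (Set.ncard_le_ncard hsub (hGf.image _)).trans
    ((Set.ncard_image_le hGf).trans hGc)⟩

theorem foldr_comp_append (l m : List ℂ[X]) :
    (l ++ m).foldr comp X = (l.foldr comp X).comp (m.foldr comp X) := by
  induction l with
  | nil => simp
  | cons a l ih => simp [ih, comp_assoc]

theorem foldr_comp_mem {S : Set ℂ[X]} (hcomp : ∀ p ∈ S, ∀ q ∈ S, p.comp q ∈ S)
    {l : List ℂ[X]} (hl : ∀ p ∈ l, p ∈ S) (h0 : l ≠ []) : l.foldr comp X ∈ S := by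
  induction l with
  | nil => exact absurd rfl h0
  | cons a l ih =>
    by_cases hn : l = []
    · subst hn; simpa using hl
    · exact hcomp _ (hl a (by simp)) _ (ih (fun p hp => hl p (by simp [hp])) hn)

theorem natDegree_foldr_comp (l : List ℂ[X]) :
    (l.foldr comp X).natDegree = (l.map natDegree).prod := by
  induction l with
  | nil => simp
  | cons a l ih => simp [natDegree_comp, ih]

theorem exists_common_left_multiple_of_relation {S : Set ℂ[X]}
    (hdeg : ∀ p ∈ S, 0 < p.natDegree) (hcomp : ∀ p ∈ S, ∀ q ∈ S, p.comp q ∈ S)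
    {s : Fin 2 → ℂ[X]} (hs : ∀ i, s i ∈ S) (l : List (Fin 2)) :
    ∀ m : List (Fin 2), l ≠ m → (l.map s).foldr comp X = (m.map s).foldr comp X →
      ∃ U ∈ S, ∃ V ∈ S, U.comp (s 0) = V.comp (s 1) := by
  have hmul : ∀ (p : ℂ[X]) (l : List (Fin 2)), p ∈ S → p.comp ((l.map s).foldr comp X) ∈ S := by
    intro p l hp
    have := foldr_comp_mem hcomp (l := p :: l.map s) (List.forall_mem_cons.mpr
      ⟨hp, List.forall_mem_map.mpr fun i _ => hs i⟩) (by simp)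
    simpa using this
  have hne : ∀ i j : Fin 2, i ≠ j → (∃ U ∈ S, ∃ V ∈ S, U.comp (s i) = V.comp (s j)) →
      ∃ U ∈ S, ∃ V ∈ S, U.comp (s 0) = V.comp (s 1) := by
    rintro i j hij ⟨U, hU, V, hV, h⟩
    fin_cases i <;> fin_cases j
    · exact absurd rfl hij
    · exact ⟨U, hU, V, hV, h⟩
    · exact ⟨V, hV, U, hU, h.symm⟩
    · exact absurd rfl hij
  have hinv : ∀ (m : List (Fin 2)) (j : Fin 2), ((m.map s).foldr comp X).comp (s j) = X →
      ∃ U ∈ S, ∃ V ∈ S, U.comp (s 0) = V.comp (s 1) := by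
    intro m j h
    obtain ⟨i, hi⟩ : ∃ i : Fin 2, i ≠ j := ⟨j + 1, by fin_cases j <;> decide⟩
    refine hne i j hi ⟨s i, hs i, ((s i).comp (s i)).comp ((m.map s).foldr comp X),
      hmul _ _ (hcomp _ (hs i) _ (hs i)), ?_⟩
    rw [comp_assoc, h, comp_X]
  induction l using List.reverseRecOn with
  | nil =>
    intro m hm h
    rcases List.eq_nil_or_concat m with rfl | ⟨m, j, rfl⟩
    · exact absurd rfl hm
    · exact hinv m j (by simpa [foldr_comp_append, -List.foldr_append] using h.symm)
  | append_singleton l i ih =>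
    intro m hm h
    rcases List.eq_nil_or_concat m with rfl | ⟨m, j, rfl⟩
    · exact hinv l i (by simpa [foldr_comp_append, -List.foldr_append] using h)
    · have h' : ((l.map s).foldr comp X).comp (s i) = ((m.map s).foldr comp X).comp (s j) := by
        simpa [foldr_comp_append, -List.foldr_append] using h
      by_cases hij : i = j
      · subst hij
        exact ih m (fun e => hm (by rw [e, List.concat_eq_append]))
          (comp_right_cancel_s17 (hdeg _ (hs i)) h')
      · refine hne i j hij ⟨_, hmul (s i) l (hs i), _, hmul (s i) m (hs i), ?_⟩
        rw [comp_assoc, h', comp_assoc]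

theorem leftReversible_of_not_free {S : Set ℂ[X]}
    (hdeg : ∀ p ∈ S, 0 < p.natDegree) (hcomp : ∀ p ∈ S, ∀ q ∈ S, p.comp q ∈ S)
    (hfree : ¬ PolyHasFreeSG S 2) : LeftReversible S := by
  intro A hA B hB
  have hs : ∀ i, ![A, B] i ∈ S := by simp [Fin.forall_fin_two, hA, hB]
  by_contra hcon
  refine hfree ⟨![A, B], hs, fun l m _ _ h => ?_⟩
  by_contra hlm
  exact hcon (by simpa using exists_common_left_multiple_of_relation hdeg hcomp hs l m hlm h)

theorem not_free_of_card_degree_le {S : Set ℂ[X]} (hcomp : ∀ p ∈ S, ∀ q ∈ S, p.comp q ∈ S)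
    {N : ℕ} (hN : ∀ d, {p | p ∈ S ∧ p.natDegree = d}.Finite ∧
      {p | p ∈ S ∧ p.natDegree = d}.ncard ≤ N) : ¬ PolyHasFreeSG S 2 := by
  rintro ⟨s, hs, hinj⟩
  let w : Fin (N + 1) → List (Fin 2) := fun i =>
    List.replicate i 0 ++ 1 :: List.replicate (N - i) 0
  let W : Fin (N + 1) → ℂ[X] := fun i => ((w i).map s).foldr comp X
  have hw : Function.Injective w := by
    intro i j hij
    have := congrArg (List.idxOf 1) hij
    simp only [w] at this
    rw [List.idxOf_append_of_notMem (by simp [List.mem_replicate]),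
      List.idxOf_append_of_notMem (by simp [List.mem_replicate])] at this
    exact Fin.ext (by simpa using this)
  have hW : Function.Injective W := fun i j hij =>
    hw (hinj _ _ (by simp [w]) (by simp [w]) hij)
  set d := (s 0).natDegree ^ N * (s 1).natDegree
  have hsub : Set.range W ⊆ {p | p ∈ S ∧ p.natDegree = d} := by
    rintro _ ⟨i, rfl⟩
    refine ⟨foldr_comp_mem hcomp (List.forall_mem_map.mpr fun i _ => hs i) (by simp [w]), ?_⟩
    have hi : (i : ℕ) + (N - i) = N := by omega
    simp only [W, natDegree_foldr_comp, w, List.map_append, List.map_replicate, List.map_cons,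
      List.prod_append, List.prod_replicate, List.prod_cons, d]
    conv_rhs => rw [← hi, pow_add]
    ring
  have h1 := Set.ncard_le_ncard hsub (hN d).1
  rw [← Set.image_univ, Set.ncard_image_of_injective _ hW, Set.ncard_univ, Nat.card_fin] at h1
  have := (hN d).2
  omega

theorem Bdd.indicator {σ : Type*} (T : Set σ) : Bdd (T.indicator fun _ => (1 : ℝ)) :=
  ⟨1, fun s => by by_cases h : s ∈ T <;> simp [h]⟩

theorem leftReversible_of_right_amenable {S : Set ℂ[X]}
    (hcomp : ∀ p ∈ S, ∀ q ∈ S, p.comp q ∈ S) {m : Mean S} (hm : PolyRightInv S m) :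
    LeftReversible S := by
  intro A hA B hB
  by_contra! hcon
  let I : ℂ[X] → Set S := fun A => {g | ∃ U ∈ S, U.comp A = g}
  have hI : ∀ A ∈ S, m.toFun ((I A).indicator fun _ => 1) = 1 := by
    intro A hA
    rw [← hm ⟨A, hA⟩ (fun g => hcomp _ g.2 _ hA) _ (Bdd.indicator _)]
    refine Eq.trans (congrArg m.toFun (funext fun g => ?_)) m.one'
    exact Set.indicator_of_mem (s := I A) ⟨g, g.2, rfl⟩ _
  have hadd := m.map_add' _ _ (Bdd.indicator (I A)) (Bdd.indicator (I B))
  have hdisj : ∀ g, g ∈ I A → g ∉ I B := by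
    rintro g ⟨U, hU, h1⟩ ⟨V, hV, h2⟩
    exact hcon U hU V hV (h1.trans h2.symm)
  set f : S → ℝ := (I A).indicator (fun _ => 1) + (I B).indicator fun _ => 1 with hf
  have hf01 : ∀ g, f g = 0 ∨ f g = 1 := by
    intro g
    by_cases h1 : g ∈ I A
    · right; simp [hf, h1, hdisj g h1]
    · by_cases h2 : g ∈ I B <;> simp [hf, h1, h2]
  have hfb : Bdd f := ⟨1, fun g => by rcases hf01 g with h | h <;> simp [h]⟩
  have hnb : Bdd ((-1 : ℝ) • f) := ⟨1, fun g => by rcases hf01 g with h | h <;> simp [h]⟩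
  have h1b : Bdd fun _ : S => (1 : ℝ) := ⟨1, by simp⟩
  have hle := m.nonneg' ((fun _ => 1) + (-1 : ℝ) • f)
    ⟨1, fun g => by rcases hf01 g with h | h <;> simp [h]⟩
    (fun g => by rcases hf01 g with h | h <;> simp [h])
  rw [m.map_add' _ _ h1b hnb, m.map_smul' _ _ hfb, m.one', hadd, hI A hA, hI B hB] at hle
  norm_num at hle

/-- A semigroup of polynomials with boundedly many elements of each degree is right
amenable: average over the elements of a given degree, then over the degrees. -/
theorem right_amenable_of_card_degree_le {S : Set ℂ[X]} (hne : S.Nonempty)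
    (hdeg : ∀ p ∈ S, 0 < p.natDegree) (hcomp : ∀ p ∈ S, ∀ q ∈ S, p.comp q ∈ S)
    {N : ℕ} (hN : ∀ d, {p | p ∈ S ∧ p.natDegree = d}.Finite ∧
      {p | p ∈ S ∧ p.natDegree = d}.ncard ≤ N) : ∃ m : Mean S, PolyRightInv S m := by
  classical
  have hfin : ∀ d, {g : S | g.1.natDegree = d}.Finite := fun d =>
    ((hN d).1.preimage Subtype.val_injective.injOn).subset fun g hg => ⟨g.2, hg⟩
  let F : ℕ → Finset S := fun d => (hfin d).toFinset
  have hF : ∀ {d g}, g ∈ F d ↔ g.1.natDegree = d := by simp [F]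
  have hFN : ∀ d, (F d).card ≤ N := by
    intro d
    refine le_trans ?_ (hN d).2
    rw [← Set.ncard_coe_finset, ← Set.ncard_image_of_injective _ Subtype.val_injective]
    refine Set.ncard_le_ncard ?_ (hN d).1
    rintro _ ⟨g, hg, rfl⟩
    exact ⟨g.2, hF.mp hg⟩
  let R : S → S → S := fun h g => ⟨g.1.comp h.1, hcomp _ g.2 _ h.2⟩
  have hRinj : ∀ h, Function.Injective (R h) := fun h g g' e =>
    Subtype.ext (comp_right_cancel_s17 (hdeg _ h.2) (congrArg Subtype.val e))
  have hRF : ∀ (h : S) d, (F d).image (R h) ⊆ F (h.1.natDegree * d) := by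
    intro h d g' hg'
    obtain ⟨g, hg, rfl⟩ := Finset.mem_image.mp hg'
    rw [hF] at hg ⊢
    rw [natDegree_comp, hg, mul_comm]
  have hmono : ∀ (h : S) d, (F d).card ≤ (F (h.1.natDegree * d)).card := fun h d => by
    rw [← Finset.card_image_of_injective _ (hRinj h)]
    exact Finset.card_le_card (hRF h d)
  obtain ⟨d₀, hd₀⟩ : ∃ d₀, ∀ d, (F d).card ≤ (F d₀).card := by
    have hb : BddAbove (Set.range fun d => (F d).card) := ⟨N, by rintro _ ⟨d, rfl⟩; exact hFN d⟩
    obtain ⟨d₀, h⟩ := Nat.sSup_mem (Set.range_nonempty _) hb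
    exact ⟨d₀, fun d => (le_csSup hb ⟨d, rfl⟩).trans h.ge⟩
  let D : Submonoid ℕ :=
    { carrier := {d | d = 1 ∨ ∃ p ∈ S, p.natDegree = d}
      one_mem' := Or.inl rfl
      mul_mem' := by
        rintro a b (rfl | ⟨p, hp, rfl⟩) (rfl | ⟨q, hq, rfl⟩)
        · simp
        · exact Or.inr ⟨q, hq, by simp⟩
        · exact Or.inr ⟨p, hp, by simp⟩
        · exact Or.inr ⟨_, hcomp p hp q hq, natDegree_comp⟩ }
  have hmax : ∀ d : D, (F (d * d₀)).card = (F d₀).card := by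
    rintro ⟨d, rfl | ⟨p, hp, rfl⟩⟩
    · simp
    · exact le_antisymm (hd₀ _) (hmono ⟨p, hp⟩ d₀)
  have hpos : (0 : ℝ) < (F d₀).card := by
    obtain ⟨p, hp⟩ := hne
    have h1 : 0 < (F p.natDegree).card := Finset.card_pos.mpr ⟨⟨p, hp⟩, hF.mpr rfl⟩
    exact_mod_cast h1.trans_le (hd₀ _)
  have himage : ∀ (h : S) (d : D), (F (d * d₀)).image (R h) = F (h.1.natDegree * (d * d₀)) := by
    intro h d
    refine Finset.eq_of_subset_of_card_le (hRF h _) ?_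
    rw [Finset.card_image_of_injective _ (hRinj h), hmax]
    exact hd₀ _
  let E : (S → ℝ) → D → ℝ := fun f d => (∑ g ∈ F (d * d₀), f g) / (F d₀).card
  have hE : ∀ f, Bdd f → Bdd (E f) := by
    rintro f ⟨K, hK⟩
    refine ⟨K, fun d => ?_⟩
    simp only [E]
    rw [abs_div, abs_of_pos hpos, div_le_iff₀ hpos]
    calc |∑ g ∈ F (d * d₀), f g| ≤ ∑ g ∈ F (d * d₀), |f g| := Finset.abs_sum_le_sum_abs _ _
      _ ≤ ∑ _g ∈ F (d * d₀), K := Finset.sum_le_sum fun g _ => hK g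
      _ = K * (F d₀).card := by rw [Finset.sum_const, hmax, nsmul_eq_mul, mul_comm]
  obtain ⟨m, hm⟩ := exists_invariant_mean_of_countable D
  refine ⟨⟨fun f => m.toFun (E f), ?_, ?_, ?_, ?_⟩, ?_⟩
  · intro f g hf hg
    rw [← m.map_add' _ _ (hE f hf) (hE g hg)]
    congr 1
    funext d
    simp [E, Finset.sum_add_distrib, add_div]
  · intro c f hf
    rw [← m.map_smul' _ _ (hE f hf)]
    congr 1
    funext d
    simp [E, ← Finset.mul_sum, mul_div_assoc]
  · intro f hf h0
    exact m.nonneg' _ (hE f hf) fun d =>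
      div_nonneg (Finset.sum_nonneg fun g _ => h0 g) hpos.le
  · refine Eq.trans (congrArg m.toFun (funext fun d => ?_)) m.one'
    simp [E, hmax, hpos.ne']
  · intro h hc f hf
    let c : D := ⟨h.1.natDegree, Or.inr ⟨h.1, h.2, rfl⟩⟩
    change m.toFun _ = m.toFun (E f)
    rw [← hm c (E f) (hE f hf)]
    congr 1
    funext d
    have : ((c * d : D) : ℕ) * d₀ = h.1.natDegree * (d * d₀) := mul_assoc _ _ _
    simp only [E, this]
    rw [← himage, Finset.sum_image fun _ _ _ _ e => hRinj h e]

/-- A non-exceptional semigroup of (nonconstant complex) polynomials is right amenable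
if and only if it contains no free subsemigroup of rank 2. -/
theorem right_amenable_iff_no_free_rank_two
    (S : Set (Polynomial ℂ)) (hne : S.Nonempty)
    (hdeg : ∀ p ∈ S, 0 < p.natDegree)
    (hcomp : ∀ p ∈ S, ∀ q ∈ S, p.comp q ∈ S)
    (hexc : ∃ P ∈ S, ¬ IsExceptional P) :
    (∃ M : Mean S, PolyRightInv S M) ↔ ¬ PolyHasFreeSG S 2 := by
  obtain ⟨P, hP, hPe⟩ := hexc
  obtain ⟨x, y, hxy, hx, hy⟩ := exists_two_critical_points_comp_self hPe
  constructor
  · rintro ⟨m, hm⟩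
    obtain ⟨N, hN⟩ := (leftReversible_of_right_amenable hcomp hm).exists_card_degree_le
      hdeg hcomp (hcomp P hP P hP) hxy hx hy
    exact not_free_of_card_degree_le hcomp hN
  · intro hfree
    obtain ⟨N, hN⟩ := (leftReversible_of_not_free hdeg hcomp hfree).exists_card_degree_le
      hdeg hcomp (hcomp P hP P hP) hxy hx hy
    exact right_amenable_of_card_degree_le hne hdeg hcomp hN
end
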